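/- Let {X_n} be a stationary and ergodic time series with values in a finite or countably infinite set 𝒳 which is finitarily Markovian. Then almost surely lim_{n→∞} λ_n / n = 1 / p_{K(X̃⁰_{−∞})−1}(X̃_{−K(X̃⁰_{−∞})+1}^0) < ∞; in particular lim_{n→∞} n/λ_n > 0 almost surely. -/

import Mathlib

open MeasureTheory Filter Set
open scoped ENNReal Topology

noncomputable section

namespace MWPrediction

/-- The canonical two-sided path space for a process with values in `𝒳`. -/
abbrev Path (𝒳 : Type*) := ℤ → 𝒳

variable {𝒳 : Type*}

/-- The left shift `(T ω) i = ω (i+1)` on two-sided sequences. -/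
def shift (ω : Path 𝒳) : Path 𝒳 := fun i => ω (i + 1)

/-- The one-sided past `X⁰_{-∞}`, recorded as `past ω i = X_{-i}`. -/
def past (ω : Path 𝒳) : ℕ → 𝒳 := fun i => ω (-(i : ℤ))

/-- The string `s` of length `m` (read right-to-left: `s j` is the symbol at
position `t - j`) occurs in `ω` ending at time `t`. -/
def OccursAt (ω : Path 𝒳) (m : ℕ) (s : ℕ → 𝒳) (t : ℤ) : Prop :=
  ∀ j < m, ω (t - (j : ℤ)) = s j

/-- The auxiliary stopping times `ζ_n`:  `ζ_0 = 0` and `ζ_n` is obtained from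
`ζ_{n-1}` by waiting for the recurrence of the block of length `l n` ending
at `ζ_{n-1}`. -/
def zeta (l : ℕ → ℕ) (ω : Path 𝒳) : ℕ → ℤ
  | 0 => 0
  | n + 1 =>
    zeta l ω n +
      ((sInf {t : ℕ | 0 < t ∧ ∀ s < l (n + 1),
          ω (zeta l ω n - (s : ℤ) + (t : ℤ)) = ω (zeta l ω n - (s : ℤ))} : ℕ) : ℤ)

/-- `J n = min { j ≥ 1 : l (j+1) > n }`. -/
def Jfun (l : ℕ → ℕ) (n : ℕ) : ℕ := sInf {j : ℕ | 1 ≤ j ∧ n < l (j + 1)}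

/-- The auxiliary process `X̃`: `tildePast l ω i = X̃_{-i} = X_{ζ_{J(i)} - i}`. -/
def tildePast (l : ℕ → ℕ) (ω : Path 𝒳) : ℕ → 𝒳 :=
  fun i => ω (zeta l ω (Jfun l i) - (i : ℤ))

variable [MeasurableSpace 𝒳]

/-- `pstr μ m s = P(X_{-m+1}^0 = s)`, the probability that the string `s` of
length `m` (read right-to-left) occupies positions `-m+1, …, 0`.
(So `pstr μ (k+1)` is `p_k` of the paper.) -/
def pstr (μ : Measure (Path 𝒳)) (m : ℕ) (s : ℕ → 𝒳) : ℝ :=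
  (μ {ω | ∀ j < m, ω (-(j : ℤ)) = s j}).toReal

/-- `pcond μ m y s = P(X_1 = y | X_{-m+1}^0 = s)`, conditioning on `m` symbols.
(So `pcond μ m` is `p_{m-1}(·|·)` of the paper.) -/
def pcond (μ : Measure (Path 𝒳)) (m : ℕ) (y : 𝒳) (s : ℕ → 𝒳) : ℝ :=
  (μ {ω | ω 1 = y ∧ ∀ j < m, ω (-(j : ℤ)) = s j}).toReal / pstr μ m s

/-- Append `y` as the new rightmost symbol of the string `s`. -/
def withLast (y : 𝒳) (s : ℕ → 𝒳) : ℕ → 𝒳 := fun j => if j = 0 then y else s (j - 1)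

/-- The string which agrees with `b` on its rightmost `k` symbols and continues
to the left with `z`:  this is the string `(z, b_{-k+1}^0)` of the paper. -/
def prependOld (b : ℕ → 𝒳) (k : ℕ) (z : ℕ → 𝒳) : ℕ → 𝒳 :=
  fun j => if j < k then b j else z (j - k)

/-- `K` is a memory bound for the past `b`: for all `i ≥ 1`, `y` and `z ∈ 𝒳^i`,
if `p_{K+i}(z, b_{-K+1}^0, y) > 0` then
`p_{K-1}(y | b_{-K+1}^0) = p_{K+i-1}(y | z, b_{-K+1}^0)`. -/
def IsMemoryBound (μ : Measure (Path 𝒳)) (b : ℕ → 𝒳) (K : ℕ) : Prop :=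
  ∀ i : ℕ, 1 ≤ i → ∀ y : 𝒳, ∀ z : ℕ → 𝒳,
    0 < pstr μ (K + i + 1) (withLast y (prependOld b K z)) →
    pcond μ K y b = pcond μ (K + i) y (prependOld b K z)

/-- The (random) memory length `K(b)` of a one-sided path `b`: the smallest
memory bound, and `∞` if there is none. -/
def memLen (μ : Measure (Path 𝒳)) (b : ℕ → 𝒳) : ℕ∞ :=
  sInf {n : ℕ∞ | ∃ K : ℕ, n = (K : ℕ∞) ∧ IsMemoryBound μ b K}

/-- `Δ_k(b_{-k+1}^0)`. -/
def Delta (μ : Measure (Path 𝒳)) (k : ℕ) (b : ℕ → 𝒳) : ℝ :=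
  sSup {d : ℝ | ∃ i : ℕ, 1 ≤ i ∧ ∃ z : ℕ → 𝒳, ∃ x : 𝒳,
    0 < pstr μ (k + i + 1) (withLast x (prependOld b k z)) ∧
    d = |pcond μ k x b - pcond μ (k + i) x (prependOld b k z)|}

/-- `⌈n/2⌉`. -/
def half (n : ℕ) : ℕ := (n + 1) / 2

open Classical in
/-- The number of times `t ∈ [a, b]` at which the string `s` of length `m`
occurs in `ω` ending at `t`. -/
def cnt (ω : Path 𝒳) (m : ℕ) (s : ℕ → 𝒳) (a b : ℤ) : ℕ :=
  ((Finset.Icc a b).filter fun t => OccursAt ω m s t).card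

/-- Membership in `ℒ_{n,m}^{(1)}`: the string `s` of length `m+1` occurs in
`X_0^{⌈n/2⌉ - 1}`. -/
def inL1 (ω : Path 𝒳) (n m : ℕ) (s : ℕ → 𝒳) : Prop :=
  ∃ t : ℤ, (m : ℤ) ≤ t ∧ t ≤ (half n : ℤ) - 1 ∧ OccursAt ω (m + 1) s t

/-- Membership in `ℒ_{n,m}^{(2)}`: the string `s` of length `m+1` occurs more
than `n^{1-γ}` times in `X_{⌈n/2⌉}^n`. -/
def inL2 (γ : ℝ) (ω : Path 𝒳) (n m : ℕ) (s : ℕ → 𝒳) : Prop :=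
  (n : ℝ) ^ (1 - γ) < (cnt ω (m + 1) s ((half n : ℤ) + (m : ℤ)) (n : ℤ) : ℝ)

/-- Membership in `ℒ_m^n = ℒ_{n,m}^{(1)} ∩ ℒ_{n,m}^{(2)}`. -/
def inL (γ : ℝ) (ω : Path 𝒳) (n m : ℕ) (s : ℕ → 𝒳) : Prop :=
  inL1 ω n m s ∧ inL2 γ ω n m s

/-- The empirical conditional relative frequency of `x` following the string
`s` of length `m`, computed in the second half `X_{⌈n/2⌉}^n` of the data. -/
def empCond (ω : Path 𝒳) (n m : ℕ) (x : 𝒳) (s : ℕ → 𝒳) : ℝ :=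
  (cnt ω (m + 1) (withLast x s) ((half n : ℤ) + (m : ℤ)) (n : ℤ) : ℝ) /
    (cnt ω m s ((half n : ℤ) + (m : ℤ) - 1) ((n : ℤ) - 1) : ℝ)

/-- The empirical statistic `Δ̂_k^n(X̃_{-k+1}^0)`. -/
def hatDelta (γ : ℝ) (l : ℕ → ℕ) (ω : Path 𝒳) (n k : ℕ) : ℝ :=
  (if zeta l ω (Jfun l k) ≤ (half n : ℤ) - 1 then (1 : ℝ) else 0) *
    sSup {d : ℝ | ∃ i : ℕ, 1 ≤ i ∧ i ≤ n ∧ ∃ z : ℕ → 𝒳, ∃ x : 𝒳,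
      inL γ ω n (k + i) (withLast x (prependOld (tildePast l ω) k z)) ∧
      d = |empCond ω n k x (tildePast l ω) -
            empCond ω n (k + i) x (prependOld (tildePast l ω) k z)|}

/-- The order estimate `χ_n`: the smallest `0 ≤ k < n` with `Δ̂_k^n ≤ n^{-β}`
(and `χ_0 = 0`). -/
def chi (β γ : ℝ) (l : ℕ → ℕ) (ω : Path 𝒳) (n : ℕ) : ℕ :=
  sInf {k : ℕ | k < n ∧ hatDelta γ l ω n k ≤ (n : ℝ) ^ (-β)}

/-- The index `j` with `ζ_j ≤ v < ζ_{j+1}`. -/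
def jIndex (l : ℕ → ℕ) (ω : Path 𝒳) (v : ℤ) : ℕ := sInf {j : ℕ | v < zeta l ω (j + 1)}

/-- The stopping times `λ_n`:  `λ_0 = 0` and, if `ζ_j ≤ λ_{n-1} < ζ_{j+1}`,
`λ_n = min { t > λ_{n-1} : X_{t - χ_t + 1}^t = X_{ζ_j - χ_t + 1}^{ζ_j} }`. -/
def lambda (β γ : ℝ) (l : ℕ → ℕ) (ω : Path 𝒳) : ℕ → ℤ
  | 0 => 0
  | n + 1 =>
    lambda β γ l ω n + 1 +
      ((sInf {s : ℕ |
          ∀ r < chi β γ l ω (lambda β γ l ω n + 1 + (s : ℤ)).toNat,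
            ω (lambda β γ l ω n + 1 + (s : ℤ) - (r : ℤ)) =
              ω (zeta l ω (jIndex l ω (lambda β γ l ω n)) - (r : ℤ))} : ℕ) : ℤ)

/-- `κ_n = χ_{λ_n}`. -/
def kappa (β γ : ℝ) (l : ℕ → ℕ) (ω : Path 𝒳) (n : ℕ) : ℕ :=
  chi β γ l ω (lambda β γ l ω n).toNat

/-- The estimator `f_n = (1/n) ∑_{j=0}^{n-1} f(X_{λ_j + 1})`. -/
def fEst (β γ : ℝ) (l : ℕ → ℕ) (f : 𝒳 → ℝ) (ω : Path 𝒳) (n : ℕ) : ℝ :=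
  (1 / (n : ℝ)) * ∑ j ∈ Finset.range n, f (ω (lambda β γ l ω j + 1))

open Classical in
/-- The metric `d*` on one-sided sequences. -/
def dstar (x y : ℕ → 𝒳) : ℝ :=
  ∑' i : ℕ, (2 : ℝ)⁻¹ ^ (i + 1) * (if x i ≠ y i then 1 else 0)

/-- `F` restricted to `C` is continuous with respect to the metric `d*`. -/
def ContinuousOnDstar (F : (ℕ → 𝒳) → ℝ) (C : Set (ℕ → 𝒳)) : Prop :=
  ∀ x ∈ C, ∀ ε > 0, ∃ δ > 0, ∀ y ∈ C, dstar x y < δ → |F y - F x| < ε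

/-- The σ-algebra generated by the one-sided past `X^0_{-∞}`. -/
def pastSigma (𝒳 : Type*) [MeasurableSpace 𝒳] : MeasurableSpace (Path 𝒳) :=
  MeasurableSpace.comap past inferInstance

/-- `F` is a version of the conditional expectation `E(f(X_1) | X^0_{-∞})`. -/
def IsPredictor (μ : Measure (Path 𝒳)) (f : 𝒳 → ℝ) (F : (ℕ → 𝒳) → ℝ) : Prop :=
  (fun ω => F (past ω)) =ᵐ[μ] μ[fun ω => f (ω 1)|pastSigma 𝒳]

/-- `F` (a version of `E(f(X_1)|X^0_{-∞})`) is almost surely continuous: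
it is continuous w.r.t. `d*` on a set of paths of probability one. -/
def ASContinuousCondExp (μ : Measure (Path 𝒳)) (F : (ℕ → 𝒳) → ℝ) : Prop :=
  ∃ C : Set (ℕ → 𝒳), μ (past ⁻¹' C) = 1 ∧ ContinuousOnDstar F C

/-- The observation `(λ_j, X_0^{λ_j})`, encoding the data segment available at
time `λ_j` (values before time `0` are clamped to `X_0`). -/
def segObs (β γ : ℝ) (l : ℕ → ℕ) (j : ℕ) (ω : Path 𝒳) : ℤ × (ℕ → 𝒳) :=
  (lambda β γ l ω j, fun i => ω (max (lambda β γ l ω j - (i : ℤ)) 0))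

/-- The σ-algebra generated by `(λ_j, X_0^{λ_j})`. -/
def segSigma (β γ : ℝ) (l : ℕ → ℕ) (j : ℕ) : MeasurableSpace (Path 𝒳) :=
  MeasurableSpace.comap (segObs β γ l j) inferInstance

/-- The observation `(λ_j, X_{-∞}^{λ_j})`: the full past at time `λ_j`. -/
def fullPastObs (β γ : ℝ) (l : ℕ → ℕ) (j : ℕ) (ω : Path 𝒳) : ℤ × (ℕ → 𝒳) :=
  (lambda β γ l ω j, fun i => ω (lambda β γ l ω j - (i : ℤ)))

/-- The σ-algebra generated by `(λ_j, X_{-∞}^{λ_j})`. -/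
def fullPastSigma (β γ : ℝ) (l : ℕ → ℕ) (j : ℕ) : MeasurableSpace (Path 𝒳) :=
  MeasurableSpace.comap (fullPastObs β γ l j) inferInstance

/-- The `n`-th term `-(1/(n+1)) ∑ p log₂ p` of the entropy rate. -/
def entropyTerm (μ : Measure (Path 𝒳)) (n : ℕ) : ℝ :=
  -(1 / ((n : ℝ) + 1)) *
    ∑' s : Fin (n + 1) → 𝒳,
      pstr μ (n + 1) (fun j => if h : j < n + 1 then s ⟨j, h⟩ else s ⟨0, Nat.succ_pos n⟩) *
        Real.logb 2
          (pstr μ (n + 1) (fun j => if h : j < n + 1 then s ⟨j, h⟩ else s ⟨0, Nat.succ_pos n⟩))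

/-- The process has entropy rate `H`. -/
def HasEntropyRate (μ : Measure (Path 𝒳)) (H : ℝ) : Prop :=
  Tendsto (entropyTerm μ) atTop (nhds H)

/-- The backward stopping times `ζ̂_i^k`. -/
def hatZeta (l : ℕ → ℕ) (k : ℕ) (ω : Path 𝒳) : ℕ → ℤ
  | 0 => 0
  | i + 1 =>
    hatZeta l k ω i -
      ((sInf {t : ℕ | 0 < t ∧ ∀ s < l (k - i),
          ω (hatZeta l k ω i - (s : ℤ) - (t : ℤ)) = ω (hatZeta l k ω i - (s : ℤ))} : ℕ) : ℤ)

section Birkhoff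

variable {Ω : Type*} [MeasurableSpace Ω] {ν : Measure Ω} {T : Ω → Ω} {g : Ω → ℝ}

/-- The running maximum of the first `n` Birkhoff sums, starting from the empty sum. -/
def birkhoffMax (T : Ω → Ω) (g : Ω → ℝ) : ℕ → Ω → ℝ
  | 0 => fun _ => 0
  | n + 1 => fun x => max 0 (g x + birkhoffMax T g n (T x))

omit [MeasurableSpace Ω] in
lemma birkhoffMax_nonneg (n : ℕ) (x : Ω) : 0 ≤ birkhoffMax T g n x := by
  cases n with
  | zero => exact le_rfl
  | succ n => exact le_max_left _ _

omit [MeasurableSpace Ω] in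
lemma birkhoffMax_le_succ (n : ℕ) (x : Ω) :
    birkhoffMax T g n x ≤ birkhoffMax T g (n + 1) x := by
  induction n generalizing x with
  | zero => exact birkhoffMax_nonneg 1 x
  | succ n ih =>
    change max 0 (g x + birkhoffMax T g n (T x)) ≤ max 0 (g x + birkhoffMax T g (n + 1) (T x))
    gcongr
    exact ih _

omit [MeasurableSpace Ω] in
lemma birkhoffSum_le_birkhoffMax {k n : ℕ} (h : k ≤ n) (x : Ω) :
    birkhoffSum T g k x ≤ birkhoffMax T g n x := by
  induction n generalizing k x with
  | zero => simp [Nat.le_zero.mp h, birkhoffMax]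
  | succ n ih =>
    cases k with
    | zero => simpa using birkhoffMax_nonneg (n + 1) x
    | succ k =>
      rw [birkhoffSum_succ']
      exact le_max_of_le_right (by gcongr; exact ih (by omega) _)

lemma integrable_birkhoffMax [IsFiniteMeasure ν] (hT : MeasurePreserving T ν ν)
    (hg : Integrable g ν) (n : ℕ) : Integrable (birkhoffMax T g n) ν := by
  induction n with
  | zero => exact integrable_zero _ _ _
  | succ n ih =>
    exact (integrable_zero Ω ℝ ν).sup (hg.add (hT.integrable_comp_of_integrable ih))

lemma measurableSet_not_bddAbove_birkhoffSum (hT : Measurable T) (hg : Measurable g) :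
    MeasurableSet {x | ¬ BddAbove (range fun n => birkhoffSum T g n x)} := by
  have hm (n : ℕ) : Measurable (birkhoffSum T g n) := by
    unfold birkhoffSum
    exact Finset.measurable_sum _ fun k _ => hg.comp (hT.iterate k)
  have : {x | ¬ BddAbove (range fun n => birkhoffSum T g n x)} =
      ⋂ N : ℕ, ⋃ n : ℕ, {x | (N : ℝ) < birkhoffSum T g n x} := by
    ext x
    simp only [mem_ofPred_eq, mem_iInter, mem_iUnion, not_bddAbove_iff, mem_range,
      exists_exists_eq_and]
    refine ⟨fun h N => h N, fun h r => ?_⟩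
    obtain ⟨N, hN⟩ := exists_nat_gt r
    obtain ⟨n, hn⟩ := h N
    exact ⟨n, hN.trans hn⟩
  rw [this]
  exact .iInter fun N => .iUnion fun n => measurableSet_lt measurable_const (hm n)

omit [MeasurableSpace Ω] in
lemma preimage_not_bddAbove_birkhoffSum :
    T ⁻¹' {x | ¬ BddAbove (range fun n => birkhoffSum T g n x)} =
      {x | ¬ BddAbove (range fun n => birkhoffSum T g n x)} := by
  ext x
  simp only [mem_preimage, mem_ofPred_eq, not_iff_not]
  constructor
  · rintro ⟨C, hC⟩
    refine ⟨max 0 (g x + C), ?_⟩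
    rintro _ ⟨n, rfl⟩
    cases n with
    | zero => simp
    | succ n =>
      simp only [birkhoffSum_succ']
      exact le_max_of_le_right (by gcongr; exact hC ⟨n, rfl⟩)
  · rintro ⟨C, hC⟩
    refine ⟨C - g x, ?_⟩
    rintro _ ⟨n, rfl⟩
    have := hC ⟨n + 1, rfl⟩
    simp only [birkhoffSum_succ'] at this
    simp only
    linarith

/-- For an ergodic transformation, the Birkhoff sums of an integrable function of negative
integral are almost surely bounded above. -/
lemma ae_bddAbove_birkhoffSum [IsProbabilityMeasure ν] (hT : Ergodic T ν) (hg : Measurable g)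
    (hgi : Integrable g ν) (hneg : ∫ x, g x ∂ν < 0) :
    ∀ᵐ x ∂ν, BddAbove (range fun n => birkhoffSum T g n x) := by
  rcases hT.measure_self_or_compl_eq_zero
    (measurableSet_not_bddAbove_birkhoffSum hT.measurable hg)
    preimage_not_bddAbove_birkhoffSum with h | h
  · exact h
  exfalso
  have hE : ∀ᵐ x ∂ν, ¬ BddAbove (range fun n => birkhoffSum T g n x) := by
    filter_upwards [measure_eq_zero_iff_ae_notMem.mp h] with x hx
    simpa using hx
  have hE' : ∀ᵐ x ∂ν, ¬ BddAbove (range fun n => birkhoffSum T g n (T x)) :=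
    hT.quasiMeasurePreserving.ae hE
  have hi := integrable_birkhoffMax hT.toMeasurePreserving hgi
  have hi' (n : ℕ) : Integrable (fun x => birkhoffMax T g n (T x)) ν :=
    hT.toMeasurePreserving.integrable_comp_of_integrable (hi n)
  have hlim : Tendsto (fun n => ∫ x, (birkhoffMax T g (n + 1) x - birkhoffMax T g n (T x)) ∂ν)
      atTop (𝓝 (∫ x, g x ∂ν)) := by
    refine tendsto_integral_of_dominated_convergence (fun x => |g x|)
      (fun n => ((hi (n + 1)).sub (hi' n)).aestronglyMeasurable) hgi.abs ?_ ?_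
    · refine fun n => ae_of_all _ fun x => ?_
      have h0 := birkhoffMax_nonneg (T := T) (g := g) n (T x)
      change |max 0 (g x + birkhoffMax T g n (T x)) - birkhoffMax T g n (T x)| ≤ |g x|
      rcases le_total 0 (g x + birkhoffMax T g n (T x)) with h1 | h1
      · rw [max_eq_right h1, add_sub_cancel_right]
      · rw [max_eq_left h1, zero_sub, abs_neg, abs_of_nonneg h0, abs_of_nonpos (by linarith)]
        linarith
    · filter_upwards [hE'] with x hx
      refine tendsto_const_nhds.congr' ?_
      rw [not_bddAbove_iff] at hx
      obtain ⟨_, ⟨N, rfl⟩, hN⟩ := hx (-g x)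
      filter_upwards [eventually_ge_atTop N] with n hn
      have := birkhoffSum_le_birkhoffMax (T := T) (g := g) hn (T x)
      change _ = max 0 (g x + birkhoffMax T g n (T x)) - birkhoffMax T g n (T x)
      rw [max_eq_right (by linarith), add_sub_cancel_right]
  refine absurd (ge_of_tendsto' hlim fun n => ?_) (not_le.mpr hneg)
  have hcomp : ∫ x, birkhoffMax T g n (T x) ∂ν = ∫ x, birkhoffMax T g n x ∂ν := by
    conv_rhs => rw [← hT.toMeasurePreserving.map_eq]
    refine (integral_map hT.measurable.aemeasurable ?_).symm
    rw [hT.toMeasurePreserving.map_eq]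
    exact (hi n).aestronglyMeasurable
  rw [integral_sub (hi _) (hi' _), hcomp, sub_nonneg]
  exact integral_mono (hi _) (hi _) fun x => birkhoffMax_le_succ n x

/-- One half of the pointwise ergodic theorem: eventual upper bounds for the averages. -/
lemma ae_eventually_birkhoffSum_le [IsProbabilityMeasure ν] (hT : Ergodic T ν)
    (hg : Measurable g) (hgi : Integrable g ν) {ε : ℝ} (hε : 0 < ε) :
    ∀ᵐ x ∂ν, ∀ᶠ n : ℕ in atTop, birkhoffSum T g n x / n ≤ (∫ y, g y ∂ν) + ε := by
  set c := (∫ y, g y ∂ν) + ε / 2 with hc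
  have h := ae_bddAbove_birkhoffSum (g := fun x => g x - c) hT (hg.sub_const c)
    (hgi.sub (integrable_const c)) (by
      rw [integral_sub hgi (integrable_const c)]
      simp only [integral_const, probReal_univ, one_smul]
      linarith)
  filter_upwards [h] with x ⟨C, hC⟩
  obtain ⟨N, hN⟩ := exists_nat_gt (C / (ε / 2))
  filter_upwards [eventually_ge_atTop (max N 1)] with n hn
  have hn1 : (1 : ℝ) ≤ n := by exact_mod_cast (le_max_right N 1).trans hn
  have hnN : (N : ℝ) ≤ n := by exact_mod_cast (le_max_left N 1).trans hn
  have h1 : birkhoffSum T (fun x => g x - c) n x ≤ C := hC ⟨n, rfl⟩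
  have h2 : birkhoffSum T (fun x => g x - c) n x = birkhoffSum T g n x - n * c := by
    simp [birkhoffSum, Finset.sum_sub_distrib]
  rw [div_lt_iff₀ (by positivity)] at hN
  rw [div_le_iff₀ (by linarith)]
  nlinarith

/-- The pointwise ergodic theorem for ergodic transformations. -/
theorem ae_tendsto_birkhoffSum_div [IsProbabilityMeasure ν] (hT : Ergodic T ν)
    (hg : Measurable g) (hgi : Integrable g ν) :
    ∀ᵐ x ∂ν, Tendsto (fun n : ℕ => birkhoffSum T g n x / n) atTop (𝓝 (∫ y, g y ∂ν)) := by
  have hu : ∀ᵐ x ∂ν, ∀ k : ℕ, ∀ᶠ n : ℕ in atTop,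
      birkhoffSum T g n x / n ≤ (∫ y, g y ∂ν) + 1 / ((k : ℝ) + 1) :=
    ae_all_iff.mpr fun k => ae_eventually_birkhoffSum_le hT hg hgi (by positivity)
  have hl : ∀ᵐ x ∂ν, ∀ k : ℕ, ∀ᶠ n : ℕ in atTop,
      birkhoffSum T (fun x => -g x) n x / n ≤ (∫ y, -g y ∂ν) + 1 / ((k : ℝ) + 1) :=
    ae_all_iff.mpr fun k => ae_eventually_birkhoffSum_le hT hg.neg hgi.neg (by positivity)
  filter_upwards [hu, hl] with x hux hlx
  rw [Metric.tendsto_atTop']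
  intro ε hε
  obtain ⟨k, hk⟩ := exists_nat_one_div_lt hε
  obtain ⟨N, hN⟩ := eventually_atTop.mp ((hux k).and (hlx k))
  refine ⟨N, fun n hn => ?_⟩
  obtain ⟨h1, h2⟩ := hN n hn.le
  have h3 : birkhoffSum T (fun x => -g x) n x = -birkhoffSum T g n x := by
    simp [birkhoffSum]
  rw [h3, integral_neg, neg_div] at h2
  rw [Real.dist_eq, abs_lt]
  constructor <;> linarith

end Birkhoff

section Words

variable {m : ℕ} {s s' : ℕ → 𝒳} {ω ω' : Path 𝒳} {t : ℤ}

/-- The word of `ω` read to the left from time `t`. -/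
def word (ω : Path 𝒳) (t : ℤ) : ℕ → 𝒳 := fun j => ω (t - (j : ℤ))

/-- Translation of a path by an arbitrary integer. -/
def shiftBy (k : ℤ) (ω : Path 𝒳) : Path 𝒳 := fun i => ω (i + k)

omit [MeasurableSpace 𝒳]

lemma shift_iterate (n : ℕ) : (shift : Path 𝒳 → Path 𝒳)^[n] = shiftBy (n : ℤ) := by
  induction n with
  | zero => ext ω i; simp [shiftBy]
  | succ n ih =>
    rw [Function.iterate_succ', ih]
    ext ω i
    simp only [Function.comp_apply, shift, shiftBy]
    congr 1
    push_cast
    ring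

lemma occursAt_congr (h : ∀ j < m, s j = s' j) : OccursAt ω m s t ↔ OccursAt ω m s' t :=
  forall₂_congr fun j hj => by rw [h j hj]

lemma occursAt_shiftBy (k : ℤ) : OccursAt (shiftBy k ω) m s t ↔ OccursAt ω m s (t + k) :=
  forall₂_congr fun j _ => by rw [shiftBy, sub_add_eq_add_sub]

lemma OccursAt.mono {m' : ℕ} (h : OccursAt ω m s t) (hm : m' ≤ m) : OccursAt ω m' s t :=
  fun j hj => h j (hj.trans_le hm)

lemma occursAt_withLast {x : 𝒳} :
    OccursAt ω (m + 1) (withLast x s) t ↔ ω t = x ∧ OccursAt ω m s (t - 1) := by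
  constructor
  · refine fun h => ⟨by simpa [withLast] using h 0 m.succ_pos, fun j hj => ?_⟩
    have := h (j + 1) (by omega)
    simp only [withLast, Nat.add_eq_zero_iff, one_ne_zero, and_false, if_false,
      Nat.add_sub_cancel] at this
    rw [← this]
    congr 1
    push_cast
    ring
  · rintro ⟨h0, h⟩ (_ | j) hj
    · simpa [withLast] using h0
    · simp only [withLast, Nat.add_eq_zero_iff, one_ne_zero, and_false, if_false,
        Nat.add_sub_cancel]
      rw [← h j (by omega)]
      congr 1
      push_cast
      ring

lemma withLast_word (ω : Path 𝒳) (t : ℤ) : withLast (ω t) (word ω (t - 1)) = word ω t := by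
  funext j
  rcases j with _ | j
  · simp [withLast, word]
  · simp only [withLast, word, Nat.add_eq_zero_iff, one_ne_zero, and_false, if_false,
      Nat.add_sub_cancel]
    congr 1
    push_cast
    ring

lemma withLast_congr {x : 𝒳} (h : ∀ j < m, s j = s' j) :
    ∀ j < m + 1, withLast x s j = withLast x s' j := by
  intro j hj
  rcases j with _ | j
  · simp [withLast]
  · simpa [withLast] using h j (by omega)

lemma prependOld_of_lt {k j : ℕ} (h : j < k) (b z : ℕ → 𝒳) : prependOld b k z j = b j :=
  if_pos h

lemma prependOld_self_drop (b : ℕ → 𝒳) (k : ℕ) : prependOld b k (fun j => b (j + k)) = b := by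
  funext j
  simp only [prependOld]
  split_ifs with h
  · rfl
  · rw [Nat.sub_add_cancel (by omega)]

lemma prependOld_congr {k : ℕ} (h : ∀ j < k, s j = s' j) (z : ℕ → 𝒳) :
    prependOld s k z = prependOld s' k z := by
  funext j
  simp only [prependOld]
  split_ifs with hj
  · exact h j hj
  · rfl

end Words

section Stationary

variable {μ : Measure (Path 𝒳)} {m : ℕ} {s s' : ℕ → 𝒳} {t : ℤ}

lemma pstr_congr (h : ∀ j < m, s j = s' j) : pstr μ m s = pstr μ m s' := by
  unfold pstr
  congr 2
  ext ω
  exact forall₂_congr fun j hj => by rw [h j hj]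

lemma pcond_congr {y : 𝒳} (h : ∀ j < m, s j = s' j) : pcond μ m y s = pcond μ m y s' := by
  unfold pcond
  rw [pstr_congr h]
  congr 3
  ext ω
  exact and_congr_right fun _ => forall₂_congr fun j hj => by rw [h j hj]

lemma isMemoryBound_congr (h : ∀ j < m, s j = s' j) :
    IsMemoryBound μ s m ↔ IsMemoryBound μ s' m := by
  unfold IsMemoryBound
  simp only [prependOld_congr h, pcond_congr h]

lemma pstr_nonneg (μ : Measure (Path 𝒳)) (m : ℕ) (s : ℕ → 𝒳) : 0 ≤ pstr μ m s :=
  ENNReal.toReal_nonneg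

lemma measurable_shiftBy (k : ℤ) : Measurable (shiftBy k : Path 𝒳 → Path 𝒳) :=
  measurable_pi_lambda _ fun i => measurable_pi_apply (i + k)

lemma measurePreserving_shiftBy (hS : MeasurePreserving (shift : Path 𝒳 → Path 𝒳) μ μ) (k : ℤ) :
    MeasurePreserving (shiftBy k : Path 𝒳 → Path 𝒳) μ μ := by
  have hpos (n : ℕ) : MeasurePreserving (shiftBy (n : ℤ) : Path 𝒳 → Path 𝒳) μ μ :=
    shift_iterate (𝒳 := 𝒳) n ▸ hS.iterate n
  rcases Int.eq_nat_or_neg k with ⟨n, rfl | rfl⟩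
  · exact hpos n
  · refine ⟨measurable_shiftBy _, ?_⟩
    conv_lhs => rw [← (hpos n).map_eq]
    rw [Measure.map_map (measurable_shiftBy _) (measurable_shiftBy _)]
    convert Measure.map_id
    ext ω i
    simp [shiftBy]

variable [MeasurableSingletonClass 𝒳]

lemma measurableSet_occursAt (m : ℕ) (s : ℕ → 𝒳) (t : ℤ) :
    MeasurableSet {ω : Path 𝒳 | OccursAt ω m s t} := by
  have : {ω : Path 𝒳 | OccursAt ω m s t} =
      ⋂ j : ℕ, ⋂ _ : j < m, (fun ω : Path 𝒳 => ω (t - (j : ℤ))) ⁻¹' {s j} := by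
    ext ω; simp [OccursAt]
  rw [this]
  exact .iInter fun j => .iInter fun _ => measurable_pi_apply _ (measurableSet_singleton _)

lemma measure_occursAt [IsFiniteMeasure μ]
    (hS : MeasurePreserving (shift : Path 𝒳 → Path 𝒳) μ μ) (m : ℕ) (s : ℕ → 𝒳) (t : ℤ) :
    μ {ω | OccursAt ω m s t} = ENNReal.ofReal (pstr μ m s) := by
  have h := (measurePreserving_shiftBy hS t).measure_preimage
    (measurableSet_occursAt m s 0).nullMeasurableSet
  have h1 : shiftBy t ⁻¹' {ω : Path 𝒳 | OccursAt ω m s 0} = {ω | OccursAt ω m s t} := by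
    ext ω
    simp [occursAt_shiftBy]
  have h2 : {ω : Path 𝒳 | ∀ j < m, ω (-(j : ℤ)) = s j} = {ω | OccursAt ω m s 0} := by
    ext ω
    simp [OccursAt]
  rw [h1] at h
  rw [h, pstr, ENNReal.ofReal_toReal (measure_ne_top _ _), h2]

lemma pcond_eq_div [IsFiniteMeasure μ]
    (hS : MeasurePreserving (shift : Path 𝒳 → Path 𝒳) μ μ) (m : ℕ) (y : 𝒳) (s : ℕ → 𝒳) :
    pcond μ m y s = pstr μ (m + 1) (withLast y s) / pstr μ m s := by
  have h := measure_occursAt hS (m + 1) (withLast y s) 1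
  have h2 : {ω : Path 𝒳 | ω 1 = y ∧ ∀ j < m, ω (-(j : ℤ)) = s j} =
      {ω | OccursAt ω (m + 1) (withLast y s) 1} := by
    ext ω
    change _ ↔ OccursAt ω (m + 1) (withLast y s) 1
    rw [occursAt_withLast]
    simp [OccursAt]
  rw [pcond, h2, h, ENNReal.toReal_ofReal (pstr_nonneg _ _ _)]

omit [MeasurableSingletonClass 𝒳] in
lemma pstr_anti [IsFiniteMeasure μ] {m' : ℕ} (h : m' ≤ m) (s : ℕ → 𝒳) :
    pstr μ m s ≤ pstr μ m' s :=
  ENNReal.toReal_mono (measure_ne_top _ _)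
    (measure_mono fun _ hω j hj => hω j (hj.trans_le h))

lemma pstr_withLast_le [IsFiniteMeasure μ]
    (hS : MeasurePreserving (shift : Path 𝒳 → Path 𝒳) μ μ) (m : ℕ) (y : 𝒳) (s : ℕ → 𝒳) :
    pstr μ (m + 1) (withLast y s) ≤ pstr μ m s := by
  rw [← ENNReal.ofReal_le_ofReal_iff (pstr_nonneg _ _ _), ← measure_occursAt hS _ _ 1,
    ← measure_occursAt hS _ _ 0]
  exact measure_mono fun ω hω => by simpa using (occursAt_withLast.mp hω).2

/-- The cylinders determined by the blocks of length `m` ending at time `t` form a countable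
measurable partition. -/
lemma exists_block_partition (m : ℕ) (t : ℤ) :
    ∃ S : (Fin m → 𝒳) → Set (Path 𝒳), (∀ u, MeasurableSet (S u)) ∧ (⋃ u, S u) = univ ∧
      Pairwise (Function.onFun Disjoint S) ∧
      ∀ u, S u = ∅ ∨ ∃ ω₀, S u = {ω | OccursAt ω m (word ω₀ t) t} := by
  refine ⟨fun u => {ω | ∀ j : Fin m, ω (t - (j : ℤ)) = u j}, fun u => ?_, ?_, ?_, fun u => ?_⟩
  · have : {ω : Path 𝒳 | ∀ j : Fin m, ω (t - (j : ℤ)) = u j} =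
        ⋂ j : Fin m, (fun ω : Path 𝒳 => ω (t - (j : ℤ))) ⁻¹' {u j} := by
      ext ω; simp
    change MeasurableSet {ω : Path 𝒳 | ∀ j : Fin m, ω (t - (j : ℤ)) = u j}
    rw [this]
    exact .iInter fun j => measurable_pi_apply _ (measurableSet_singleton _)
  · ext ω
    simp only [mem_iUnion, mem_univ, iff_true]
    exact ⟨fun j => ω (t - (j : ℤ)), fun j => rfl⟩
  · intro u v huv
    refine Set.disjoint_left.mpr fun ω hu hv => huv (funext fun j => ?_)
    rw [← hu j, ← hv j]
  · rcases Set.eq_empty_or_nonempty {ω : Path 𝒳 | ∀ j : Fin m, ω (t - (j : ℤ)) = u j} with h | h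
    · exact .inl h
    · obtain ⟨ω₀, h₀⟩ := h
      refine .inr ⟨ω₀, ?_⟩
      ext ω
      simp only [mem_ofPred_eq, OccursAt, word]
      refine ⟨fun h j hj => (h ⟨j, hj⟩).trans (h₀ ⟨j, hj⟩).symm,
        fun h j => (h j j.2).trans (h₀ j)⟩

variable [Countable 𝒳]

lemma lintegral_le_of_forall_block (m : ℕ) (t : ℤ) {f g : Path 𝒳 → ℝ≥0∞}
    (h : ∀ ω₀ : Path 𝒳, ∫⁻ ω in {ω | OccursAt ω m (word ω₀ t) t}, f ω ∂μ ≤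
      ∫⁻ ω in {ω | OccursAt ω m (word ω₀ t) t}, g ω ∂μ) :
    ∫⁻ ω, f ω ∂μ ≤ ∫⁻ ω, g ω ∂μ := by
  obtain ⟨S, hm, hU, hd, hS⟩ := exists_block_partition (𝒳 := 𝒳) m t
  rw [← setLIntegral_univ f, ← setLIntegral_univ g, ← hU, lintegral_iUnion hm hd,
    lintegral_iUnion hm hd]
  refine ENNReal.tsum_le_tsum fun u => ?_
  rcases hS u with h0 | ⟨ω₀, h0⟩
  · simp [h0]
  · rw [h0]
    exact h ω₀

/-- Almost surely, every block that is read along the path has positive probability. -/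
lemma ae_pstr_word_pos [IsFiniteMeasure μ]
    (hS : MeasurePreserving (shift : Path 𝒳 → Path 𝒳) μ μ) :
    ∀ᵐ ω ∂μ, ∀ (m : ℕ) (t : ℤ), 0 < pstr μ m (word ω t) := by
  refine ae_all_iff.mpr fun m => ae_all_iff.mpr fun t => ?_
  obtain ⟨S, -, hU, -, hSu⟩ := exists_block_partition (𝒳 := 𝒳) m t
  have : ∀ᵐ ω ∂μ, ∀ u, μ (S u) = 0 → ω ∉ S u := by
    refine ae_all_iff.mpr fun u => ?_
    by_cases h : μ (S u) = 0
    · filter_upwards [measure_eq_zero_iff_ae_notMem.mp h] with ω hω _ using hω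
    · exact ae_of_all _ fun ω h' => absurd h' h
  filter_upwards [this] with ω hω
  obtain ⟨u, hu⟩ := mem_iUnion.mp (hU ▸ mem_univ ω)
  refine (pstr_nonneg _ _ _).lt_of_ne fun h0 => hω u ?_ hu
  rcases hSu u with h | ⟨ω₀, h⟩
  · simp [h]
  · rw [h] at hu ⊢
    rw [measure_occursAt hS, ← pstr_congr (fun j hj => hu j hj), ENNReal.ofReal_eq_zero]
    exact h0.ge

omit [MeasurableSingletonClass 𝒳] in
/-- A property of words depending on finitely many symbols needs to be checked word by word. -/
lemma ae_forall_word [Nonempty 𝒳] {P : Path 𝒳 → (ℕ → 𝒳) → Prop}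
    (hP : ∀ ω s s', (∀ j < m, s j = s' j) → P ω s → P ω s')
    (h : ∀ s, ∀ᵐ ω ∂μ, P ω s) : ∀ᵐ ω ∂μ, ∀ s, P ω s := by
  let ext : (Fin m → 𝒳) → ℕ → 𝒳 := fun u j => if hj : j < m then u ⟨j, hj⟩
    else Classical.arbitrary 𝒳
  filter_upwards [ae_all_iff.mpr fun u : Fin m → 𝒳 => h (ext u)] with ω hω s
  refine hP ω _ s (fun j hj => ?_) (hω fun j => s j)
  simp [ext, hj]

end Stationary

section Counting

variable {μ : Measure (Path 𝒳)} {ω : Path 𝒳} {m : ℕ} {s s' : ℕ → 𝒳} {a b c : ℤ}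

omit [MeasurableSpace 𝒳]

open Classical in
lemma cnt_congr (h : ∀ j < m, s j = s' j) : cnt ω m s a b = cnt ω m s' a b := by
  unfold cnt
  congr 1
  exact Finset.filter_congr fun t _ => occursAt_congr h

open Classical in
lemma cnt_add (h1 : a ≤ b + 1) (h2 : b ≤ c) :
    cnt ω m s a b + cnt ω m s (b + 1) c = cnt ω m s a c := by
  have h : Finset.Icc a c = Finset.Icc a b ∪ Finset.Icc (b + 1) c := by
    ext t
    simp only [Finset.mem_union, Finset.mem_Icc]
    omega
  have hd : Disjoint (Finset.Icc a b) (Finset.Icc (b + 1) c) := by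
    refine Finset.disjoint_left.mpr fun t h3 h4 => ?_
    simp only [Finset.mem_Icc] at h3 h4
    omega
  simp only [cnt]
  rw [h, Finset.filter_union, Finset.card_union_of_disjoint (hd.mono (Finset.filter_subset _ _)
    (Finset.filter_subset _ _))]

open Classical in
lemma cnt_mono {a' b' : ℤ} (h1 : a' ≤ a) (h2 : b ≤ b') : cnt ω m s a b ≤ cnt ω m s a' b' :=
  Finset.card_le_card (Finset.filter_subset_filter _ (Finset.Icc_subset_Icc h1 h2))

open Classical in
lemma cnt_add_one (h : a ≤ b + 1) :
    cnt ω m s a (b + 1) = cnt ω m s a b + if OccursAt ω m s (b + 1) then 1 else 0 := by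
  rw [← cnt_add h (by omega : b ≤ b + 1)]
  congr 1
  simp [cnt, Finset.filter_singleton]
  split_ifs <;> simp

lemma cnt_of_lt (h : b < a) : cnt ω m s a b = 0 := by
  simp [cnt, h]

open Classical in
lemma cnt_eq_birkhoffSum (ω : Path 𝒳) (m : ℕ) (s : ℕ → 𝒳) (n : ℕ) :
    (cnt ω m s 0 ((n : ℤ) - 1) : ℝ) =
      birkhoffSum shift ({ω | OccursAt ω m s 0}.indicator 1) n ω := by
  induction n with
  | zero => simp [cnt]
  | succ n ih =>
    rw [birkhoffSum_succ, ← ih]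
    have := cnt_add_one (ω := ω) (m := m) (s := s) (a := 0) (b := (n : ℤ) - 1) (by omega)
    rw [sub_add_cancel] at this
    push_cast
    rw [add_sub_cancel_right, this, shift_iterate]
    push_cast
    congr 1
    simp [Set.indicator_apply, occursAt_shiftBy]

end Counting

section Frequencies

variable {μ : Measure (Path 𝒳)} {ω : Path 𝒳} [Countable 𝒳] [MeasurableSingletonClass 𝒳]

/-- Almost surely, every word occurs with the right asymptotic frequency. -/
lemma ae_tendsto_cnt_div [IsProbabilityMeasure μ]
    (hErg : Ergodic (shift : Path 𝒳 → Path 𝒳) μ) :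
    ∀ᵐ ω ∂μ, ∀ (m : ℕ) (s : ℕ → 𝒳),
      Tendsto (fun n : ℕ => (cnt ω m s 0 ((n : ℤ) - 1) : ℝ) / n) atTop (𝓝 (pstr μ m s)) := by
  have : Nonempty 𝒳 := (nonempty_of_isProbabilityMeasure μ).map fun ω => ω 0
  refine ae_all_iff.mpr fun m => ae_forall_word (m := m) ?_ fun s => ?_
  · intro ω s s' h h1
    simpa only [cnt_congr h, pstr_congr h] using h1
  · have hms := measurableSet_occursAt (𝒳 := 𝒳) m s 0
    have h := ae_tendsto_birkhoffSum_div hErg (g := {ω | OccursAt ω m s 0}.indicator 1)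
      (measurable_one.indicator hms) ((integrable_const 1).indicator hms)
    rw [integral_indicator_one hms, measureReal_def, measure_occursAt hErg.toMeasurePreserving,
      ENNReal.toReal_ofReal (pstr_nonneg _ _ _)] at h
    filter_upwards [h] with ω hω
    simpa only [cnt_eq_birkhoffSum] using hω

end Frequencies

section MemoryBounds

variable {μ : Measure (Path 𝒳)} {b : ℕ → 𝒳} {K : ℕ}

lemma IsMemoryBound.prepend [IsFiniteMeasure μ] (h : IsMemoryBound μ b K) (i : ℕ) (z : ℕ → 𝒳) :
    IsMemoryBound μ (prependOld b K z) (K + i) := by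
  intro i' hi' y z' hpos
  have h1 : prependOld (prependOld b K z) (K + i) z' =
      prependOld b K (prependOld z i z') := by
    funext j
    simp only [prependOld]
    split_ifs <;> first | rfl | omega | (congr 1; omega)
  rw [h1, add_assoc K i i'] at hpos ⊢
  rw [← h (i + i') (by omega) y _ hpos]
  rcases Nat.eq_zero_or_pos i with rfl | hi
  · rw [add_zero]
    exact (pcond_congr fun j hj => (prependOld_of_lt hj b z).symm).symm
  · refine (h i hi y z (hpos.trans_le ?_)).symm
    refine (pstr_anti (m' := K + i + 1) (by omega) _).trans_eq (pstr_congr ?_)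
    refine withLast_congr fun j hj => ?_
    simp only [prependOld]
    split_ifs <;> first | rfl | omega

lemma IsMemoryBound.mono [IsFiniteMeasure μ] (h : IsMemoryBound μ b K) {K' : ℕ} (hK : K ≤ K') :
    IsMemoryBound μ b K' := by
  obtain ⟨i, rfl⟩ := Nat.exists_eq_add_of_le hK
  simpa only [prependOld_self_drop] using h.prepend i fun j => b (j + K)

lemma memLen_ne_top_iff : memLen μ b ≠ ⊤ ↔ ∃ K : ℕ, IsMemoryBound μ b K := by
  simp only [memLen, ne_eq, sInf_eq_top, mem_ofPred_eq, not_forall]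
  constructor
  · rintro ⟨_, ⟨K, -, hK⟩, -⟩
    exact ⟨K, hK⟩
  · rintro ⟨K, hK⟩
    exact ⟨K, ⟨K, rfl, hK⟩, ENat.natCast_ne_top K⟩

lemma isMemoryBound_toNat_memLen (h : memLen μ b ≠ ⊤) :
    IsMemoryBound μ b (memLen μ b).toNat := by
  obtain ⟨K, hK⟩ := memLen_ne_top_iff.mp h
  have hmem : memLen μ b ∈ {n : ℕ∞ | ∃ K : ℕ, n = (K : ℕ∞) ∧ IsMemoryBound μ b K} :=
    csInf_mem ⟨K, K, rfl, hK⟩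
  obtain ⟨K', h1, h2⟩ := hmem
  rwa [h1, ENat.toNat_natCast]

lemma toNat_memLen_le (h : IsMemoryBound μ b K) : (memLen μ b).toNat ≤ K :=
  ENat.toNat_le_of_le_natCast (sInf_le ⟨K, rfl, h⟩)

end MemoryBounds

section ReturnTimes

variable {ω : Path 𝒳}

omit [MeasurableSpace 𝒳] in
lemma zeta_succ (l : ℕ → ℕ) (ω : Path 𝒳) (n : ℕ) :
    zeta l ω (n + 1) = zeta l ω n +
      ((sInf {t : ℕ | 0 < t ∧ OccursAt ω (l (n + 1)) (word ω (zeta l ω n))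
        (zeta l ω n + t)} : ℕ) : ℤ) := by
  simp only [zeta, OccursAt, word, sub_add_eq_add_sub]

omit [MeasurableSpace 𝒳] in
/-- Along a path in which every block recurs, `ζ` is strictly increasing and the block ending at
`ζ_n` reappears at `ζ_{n+1}`. -/
lemma zeta_succ_spec (hrec : ∀ (m : ℕ) (t a : ℤ), ∃ t' > a, OccursAt ω m (word ω t) t')
    (l : ℕ → ℕ) (n : ℕ) :
    zeta l ω n < zeta l ω (n + 1) ∧
      OccursAt ω (l (n + 1)) (word ω (zeta l ω n)) (zeta l ω (n + 1)) := by
  have hne : {t : ℕ | 0 < t ∧ OccursAt ω (l (n + 1)) (word ω (zeta l ω n))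
      (zeta l ω n + t)}.Nonempty := by
    obtain ⟨t', h1, h2⟩ := hrec (l (n + 1)) (zeta l ω n) (zeta l ω n)
    refine ⟨(t' - zeta l ω n).toNat, by omega, ?_⟩
    rwa [Int.toNat_of_nonneg (by omega), add_sub_cancel]
  obtain ⟨h1, h2⟩ := Nat.sInf_mem hne
  rw [zeta_succ]
  exact ⟨by omega, h2⟩

lemma Jfun_spec {l : ℕ → ℕ} (hltop : Tendsto l atTop atTop) (i : ℕ) :
    1 ≤ Jfun l i ∧ i < l (Jfun l i + 1) := by
  have hne : {j : ℕ | 1 ≤ j ∧ i < l (j + 1)}.Nonempty := by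
    obtain ⟨j, hj⟩ := ((((tendsto_add_atTop_iff_nat 1).mpr hltop).eventually_gt_atTop i).and
      (eventually_ge_atTop 1)).exists
    exact ⟨j, hj.2, hj.1⟩
  exact Nat.sInf_mem hne

omit [MeasurableSpace 𝒳] in
/-- The block ending at `ζ_j` agrees with the limiting past `X̃` from the index `J(m)` on. -/
lemma word_zeta_eq_tildePast
    (hrec : ∀ (m : ℕ) (t a : ℤ), ∃ t' > a, OccursAt ω m (word ω t) t')
    {l : ℕ → ℕ} (hlmono : Monotone l) (hltop : Tendsto l atTop atTop) {m j i : ℕ}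
    (hj : Jfun l m ≤ j) (hi : i ≤ m) : word ω (zeta l ω j) i = tildePast l ω i := by
  have hJ : Jfun l i ≤ Jfun l m :=
    Nat.sInf_le ⟨(Jfun_spec hltop m).1, hi.trans_lt (Jfun_spec hltop m).2⟩
  have h : ∀ j, Jfun l i ≤ j → word ω (zeta l ω j) i = tildePast l ω i := by
    intro j hij
    induction j, hij using Nat.le_induction with
    | base => rfl
    | succ j hij ih =>
      rw [← ih]
      exact (zeta_succ_spec hrec l j).2 i ((Jfun_spec hltop i).2.trans_le (hlmono (by omega)))
  exact h j (hJ.trans hj)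

/-- The first return time of the block of length `L` ending at time `0`. -/
def returnTime (L : ℕ) (ω : Path 𝒳) : ℕ :=
  sInf {t : ℕ | 0 < t ∧ OccursAt ω L (word ω 0) t}

omit [MeasurableSpace 𝒳] in
lemma shiftBy_zeta_succ (l : ℕ → ℕ) (n : ℕ) (ω : Path 𝒳) :
    shiftBy (zeta l ω (n + 1)) ω =
      shiftBy (returnTime (l (n + 1)) (shiftBy (zeta l ω n) ω)) (shiftBy (zeta l ω n) ω) := by
  have h : returnTime (l (n + 1)) (shiftBy (zeta l ω n) ω) =
      sInf {t : ℕ | 0 < t ∧ OccursAt ω (l (n + 1)) (word ω (zeta l ω n))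
        (zeta l ω n + t)} := by
    unfold returnTime
    congr 1
    ext t
    simp only [mem_ofPred_eq, occursAt_shiftBy]
    refine and_congr_right fun _ => ?_
    rw [add_comm (t : ℤ)]
    refine occursAt_congr fun j _ => ?_
    simp only [word, shiftBy]
    congr 1
    ring
  rw [h, zeta_succ]
  funext i
  simp only [shiftBy]
  congr 1
  ring

variable {μ : Measure (Path 𝒳)} [MeasurableSingletonClass 𝒳] [Countable 𝒳]

lemma measurableSet_of_block {A : Set (Path 𝒳)} (m : ℕ) (t : ℤ)
    (hA : ∀ ω ω' : Path 𝒳, OccursAt ω' m (word ω t) t → ω ∈ A → ω' ∈ A) : MeasurableSet A := by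
  obtain ⟨S, hm, hU, -, hS⟩ := exists_block_partition (𝒳 := 𝒳) m t
  have : A = ⋃ u, ⋃ _ : S u ⊆ A, S u := by
    refine subset_antisymm (fun ω hω => ?_) (iUnion₂_subset fun u hu => hu)
    obtain ⟨u, hu⟩ := mem_iUnion.mp (hU ▸ mem_univ ω)
    refine mem_iUnion₂.mpr ⟨u, fun ω' hω' => ?_, hu⟩
    rcases hS u with h | ⟨ω₀, h⟩
    · simp [h] at hu
    · rw [h] at hu hω'
      exact hA ω ω' (fun j hj => (hω' j hj).trans (hu j hj).symm) hω
  rw [this]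
  exact .iUnion fun u => .iUnion fun _ => hm u

lemma measurableSet_returnTime_eq (L : ℕ) {t : ℕ} (ht : 0 < t) :
    MeasurableSet {ω : Path 𝒳 | returnTime L ω = t} := by
  have hO (t' : ℕ) : MeasurableSet {ω : Path 𝒳 | OccursAt ω L (word ω 0) t'} := by
    have : {ω : Path 𝒳 | OccursAt ω L (word ω 0) t'} =
        ⋂ j : ℕ, ⋂ _ : j < L, {ω | ω ((t' : ℤ) - j) = ω (0 - (j : ℤ))} := by
      ext ω; simp [OccursAt, word]
    rw [this]
    exact .iInter fun j => .iInter fun _ => measurableSet_eq_fun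
      (measurable_pi_apply _) (measurable_pi_apply _)
  have : {ω : Path 𝒳 | returnTime L ω = t} = {ω | OccursAt ω L (word ω 0) t} ∩
      ⋂ t' : ℕ, ⋂ _ : 0 < t' ∧ t' < t, {ω | OccursAt ω L (word ω 0) t'}ᶜ := by
    ext ω
    simp only [mem_ofPred_eq, mem_inter_iff, mem_iInter, mem_compl_iff, and_imp]
    constructor
    · rintro rfl
      exact ⟨(Nat.sInf_mem (Nat.nonempty_of_pos_sInf ht)).2,
        fun t' h1 h2 h3 => Nat.notMem_of_lt_sInf h2 ⟨h1, h3⟩⟩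
    · rintro ⟨h1, h2⟩
      refine le_antisymm (Nat.sInf_le ⟨ht, h1⟩) (not_lt.mp fun h3 => ?_)
      have h4 := Nat.sInf_mem (s := {t : ℕ | 0 < t ∧ OccursAt ω L (word ω 0) t}) ⟨t, ht, h1⟩
      exact h2 _ h4.1 h3 h4.2
  rw [this]
  exact (hO t).inter (.iInter fun t' => .iInter fun _ => (hO t').compl)

/-- Moving a path to the first return of its own block of length `L` does not increase the
measure of any set. -/
lemma measure_preimage_returnMap_le
    (hS : MeasurePreserving (shift : Path 𝒳 → Path 𝒳) μ μ)
    (hrec : ∀ᵐ ω ∂μ, ∀ (m : ℕ) (t a : ℤ), ∃ t' > a, OccursAt ω m (word ω t) t')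
    (L : ℕ) (B : Set (Path 𝒳)) :
    μ {ω | shiftBy (returnTime L ω) ω ∈ B} ≤ μ B := by
  set B' := toMeasurable μ B
  have hB' : MeasurableSet B' := measurableSet_toMeasurable μ B
  let E : ℕ → Set (Path 𝒳) := fun t =>
    shiftBy (-((t : ℤ) + 1)) ⁻¹' {ω | returnTime L ω = t + 1}
  have hE (t : ℕ) : MeasurableSet (E t) :=
    measurable_shiftBy _ (measurableSet_returnTime_eq L t.succ_pos)
  have hEocc (t : ℕ) (ω) (h : ω ∈ E t) : ∀ j < L, ω (-(j : ℤ)) = ω (-((t : ℤ) + 1) - j) := by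
    have h1 : returnTime L (shiftBy (-((t : ℤ) + 1)) ω) = t + 1 := h
    have h2 : 0 < returnTime L (shiftBy (-((t : ℤ) + 1)) ω) := by omega
    have h3 := (Nat.sInf_mem (Nat.nonempty_of_pos_sInf h2)).2
    intro j hj
    have h4 := h3 j hj
    change shiftBy _ ω (((returnTime L _ : ℕ) : ℤ) - j) = _ at h4
    rw [h1] at h4
    simp only [shiftBy, word] at h4
    convert h4 using 2 <;> push_cast <;> ring
  have hdisj' (t t' : ℕ) (htt : t < t') (ω) (h : ω ∈ E t) (h' : ω ∈ E t') : False := by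
    have h1 : returnTime L (shiftBy (-((t' : ℤ) + 1)) ω) = t' + 1 := h'
    have h2 : t' - t < returnTime L (shiftBy (-((t' : ℤ) + 1)) ω) := by omega
    refine Nat.notMem_of_lt_sInf h2 ⟨by omega, fun j hj => ?_⟩
    simp only [shiftBy, word]
    have h3 := hEocc t ω h j hj
    have h4 := hEocc t' ω h' j hj
    rw [Nat.cast_sub htt.le]
    convert h3.symm.trans h4 using 2 <;> ring
  have hdisj : Pairwise (Function.onFun Disjoint fun t => E t ∩ B') := by
    intro t t' htt
    refine Set.disjoint_left.mpr fun ω h h' => ?_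
    rcases lt_or_gt_of_ne htt with hlt | hlt
    · exact hdisj' t t' hlt ω h.1 h'.1
    · exact hdisj' t' t hlt ω h'.1 h.1
  calc μ {ω | shiftBy (returnTime L ω) ω ∈ B}
      ≤ μ (⋃ t : ℕ, shiftBy ((t : ℤ) + 1) ⁻¹' (E t ∩ B')) := by
        refine measure_mono_ae ?_
        filter_upwards [hrec] with ω hω h
        have hne : {t : ℕ | 0 < t ∧ OccursAt ω L (word ω 0) t}.Nonempty := by
          obtain ⟨t', h1, h2⟩ := hω L 0 0
          exact ⟨t'.toNat, by omega, by rwa [Int.toNat_of_nonneg (by omega)]⟩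
        have hp : 0 < returnTime L ω := (Nat.sInf_mem hne).1
        refine mem_iUnion.mpr ⟨returnTime L ω - 1, ?_⟩
        have hc : (((returnTime L ω - 1 : ℕ) : ℤ) + 1) = returnTime L ω := by omega
        refine ⟨?_, ?_⟩
        · change returnTime L (shiftBy _ (shiftBy _ ω)) = _
          rw [hc, Nat.sub_add_cancel hp]
          congr 1
          funext i
          simp [shiftBy]
        · rw [hc]
          exact subset_toMeasurable μ B h
    _ ≤ ∑' t : ℕ, μ (shiftBy ((t : ℤ) + 1) ⁻¹' (E t ∩ B')) := measure_iUnion_le _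
    _ = ∑' t : ℕ, μ (E t ∩ B') := by
        congr 1
        funext t
        exact (measurePreserving_shiftBy hS _).measure_preimage
          ((hE t).inter hB').nullMeasurableSet
    _ = μ (⋃ t : ℕ, E t ∩ B') := (measure_iUnion hdisj fun t => (hE t).inter hB').symm
    _ ≤ μ B' := measure_mono (iUnion_subset fun t => inter_subset_right)
    _ = μ B := measure_toMeasurable B

lemma measure_preimage_shiftBy_zeta_le
    (hS : MeasurePreserving (shift : Path 𝒳 → Path 𝒳) μ μ)
    (hrec : ∀ᵐ ω ∂μ, ∀ (m : ℕ) (t a : ℤ), ∃ t' > a, OccursAt ω m (word ω t) t')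
    (l : ℕ → ℕ) (n : ℕ) (B : Set (Path 𝒳)) :
    μ {ω | shiftBy (zeta l ω n) ω ∈ B} ≤ μ B := by
  induction n generalizing B with
  | zero =>
    refine le_of_eq (congrArg μ ?_)
    ext ω
    have : shiftBy 0 ω = ω := funext fun i => by simp [shiftBy]
    simp [zeta, this]
  | succ n ih =>
    simp only [shiftBy_zeta_succ]
    exact (ih {ω | shiftBy (returnTime (l (n + 1)) ω) ω ∈ B}).trans
      (measure_preimage_returnMap_le hS hrec _ B)

/-- If the process is finitarily Markovian, then the memory length of the past `X̃` is almost
surely finite. -/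
lemma ae_memLen_tildePast_ne_top [IsFiniteMeasure μ]
    (hS : MeasurePreserving (shift : Path 𝒳 → Path 𝒳) μ μ)
    (hrec : ∀ᵐ ω ∂μ, ∀ (m : ℕ) (t a : ℤ), ∃ t' > a, OccursAt ω m (word ω t) t')
    {l : ℕ → ℕ} (hlmono : Monotone l) (hltop : Tendsto l atTop atTop)
    (hFM : ∀ᵐ ω ∂μ, memLen μ (past ω) ≠ ⊤) :
    ∀ᵐ ω ∂μ, memLen μ (tildePast l ω) ≠ ⊤ := by
  let B : ℕ → Set (Path 𝒳) := fun K => {ω | ¬ IsMemoryBound μ (past ω) K}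
  have hB (K : ℕ) : MeasurableSet (B K) := by
    refine measurableSet_of_block K 0 fun ω ω' h hω => ?_
    have : ∀ j < K, past ω' j = past ω j := fun j hj => by simpa [past, word] using h j hj
    exact fun h' => hω ((isMemoryBound_congr this).mp h')
  have hBanti : Antitone B := fun K K' hK ω hω h => hω (h.mono hK)
  have hB0 : μ (⋂ K, B K) = 0 := by
    refine measure_eq_zero_iff_ae_notMem.mpr ?_
    filter_upwards [hFM] with ω hω h
    obtain ⟨K, hK⟩ := memLen_ne_top_iff.mp hω
    exact mem_iInter.mp h K hK
  have hlim : Tendsto (fun K => μ (B K)) atTop (𝓝 0) := by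
    rw [← hB0]
    exact tendsto_measure_iInter_atTop (fun K => (hB K).nullMeasurableSet) hBanti
      ⟨0, measure_ne_top _ _⟩
  change μ {ω | ¬ memLen μ (tildePast l ω) ≠ ⊤} = 0
  refine le_antisymm (ge_of_tendsto' hlim fun K => ?_) bot_le
  refine le_trans (measure_mono_ae ?_)
    (measure_preimage_shiftBy_zeta_le hS hrec l (Jfun l K) (B K))
  filter_upwards [hrec] with ω hω h h'
  refine h (memLen_ne_top_iff.mpr ⟨K, (isMemoryBound_congr fun j hj => ?_).mp h'⟩)
  rw [← word_zeta_eq_tildePast hω hlmono hltop le_rfl hj.le]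
  simp only [past, shiftBy, word]
  congr 1
  ring

end ReturnTimes

section Recurrence

variable {μ : Measure (Path 𝒳)} {ω : Path 𝒳}

lemma exists_occursAt_gt {m : ℕ} {s : ℕ → 𝒳}
    (hfreq : Tendsto (fun n : ℕ => (cnt ω m s 0 ((n : ℤ) - 1) : ℝ) / n) atTop (𝓝 (pstr μ m s)))
    (hpos : 0 < pstr μ m s) (a : ℤ) : ∃ t > a, OccursAt ω m s t := by
  classical
  by_contra! hno
  have hb (n : ℕ) : (cnt ω m s 0 ((n : ℤ) - 1) : ℝ) ≤ (Finset.Icc 0 a).card := by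
    refine Nat.cast_le.mpr (Finset.card_le_card fun t ht => ?_)
    simp only [Finset.mem_filter, Finset.mem_Icc] at ht ⊢
    exact ⟨ht.1.1, not_lt.mp fun h => hno t h ht.2⟩
  have h0 : Tendsto (fun n : ℕ => ((Finset.Icc 0 a).card : ℝ) / n) atTop (𝓝 0) :=
    tendsto_const_nhds.div_atTop tendsto_natCast_atTop_atTop
  exact hpos.not_ge (le_of_tendsto_of_tendsto' hfreq h0 fun n => by gcongr; exact_mod_cast hb n)

end Recurrence

section ConditionalProbabilities

variable {μ : Measure (Path 𝒳)} [IsFiniteMeasure μ] [MeasurableSingletonClass 𝒳]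

omit [MeasurableSingletonClass 𝒳] in
lemma pcond_nonneg (μ : Measure (Path 𝒳)) (m : ℕ) (y : 𝒳) (s : ℕ → 𝒳) : 0 ≤ pcond μ m y s :=
  div_nonneg ENNReal.toReal_nonneg (pstr_nonneg _ _ _)

lemma pcond_le_one (hS : MeasurePreserving (shift : Path 𝒳 → Path 𝒳) μ μ) (m : ℕ) (y : 𝒳)
    (s : ℕ → 𝒳) : pcond μ m y s ≤ 1 := by
  rw [pcond_eq_div hS]
  exact div_le_one_of_le₀ (pstr_withLast_le hS m y s) (pstr_nonneg _ _ _)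

variable [Countable 𝒳]

lemma hasSum_pstr_withLast (hS : MeasurePreserving (shift : Path 𝒳 → Path 𝒳) μ μ) (m : ℕ)
    (s : ℕ → 𝒳) : HasSum (fun y => pstr μ (m + 1) (withLast y s)) (pstr μ m s) := by
  have hU : {ω : Path 𝒳 | OccursAt ω m s 0} =
      ⋃ y, {ω : Path 𝒳 | OccursAt ω (m + 1) (withLast y s) 1} := by
    ext ω
    simp [occursAt_withLast]
  have hsum := measure_iUnion (μ := μ)
    (f := fun y => {ω : Path 𝒳 | OccursAt ω (m + 1) (withLast y s) 1})
    (fun y y' hy => Set.disjoint_left.mpr fun ω h h' =>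
      hy ((occursAt_withLast.mp h).1.symm.trans (occursAt_withLast.mp h').1))
    (fun y => measurableSet_occursAt _ _ _)
  rw [← hU, measure_occursAt hS] at hsum
  simp only [measure_occursAt hS] at hsum
  have h := ENNReal.hasSum_toReal (hsum ▸ ENNReal.ofReal_ne_top)
  rw [← ENNReal.tsum_toReal_eq (fun _ => ENNReal.ofReal_ne_top), ← hsum] at h
  simpa only [ENNReal.toReal_ofReal (pstr_nonneg _ _ _)] using h

lemma hasSum_pcond (hS : MeasurePreserving (shift : Path 𝒳 → Path 𝒳) μ μ) {m : ℕ}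
    {s : ℕ → 𝒳} (h : 0 < pstr μ m s) : HasSum (fun y => pcond μ m y s) 1 := by
  simp only [pcond_eq_div hS]
  simpa only [div_self h.ne'] using (hasSum_pstr_withLast hS m s).div_const (pstr μ m s)

/-- Conditioning on more than the memory does not change the conditional probabilities. -/
lemma IsMemoryBound.pcond_eq (hS : MeasurePreserving (shift : Path 𝒳 → Path 𝒳) μ μ) {m M : ℕ}
    {s : ℕ → 𝒳} (h : IsMemoryBound μ s m) (hM : m ≤ M) (hpos : 0 < pstr μ M s) (y : 𝒳) :
    pcond μ M y s = pcond μ m y s := by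
  rcases hM.eq_or_lt with rfl | hlt
  · rfl
  have hle : ∀ y, pcond μ M y s ≤ pcond μ m y s := by
    intro y
    rcases (pstr_nonneg μ (M + 1) (withLast y s)).eq_or_lt with h0 | h0
    · rw [pcond_eq_div hS M, ← h0, zero_div]
      exact pcond_nonneg _ _ _ _
    · have h1 := h (M - m) (by omega) y (fun j => s (j + m))
      rw [prependOld_self_drop, Nat.add_sub_cancel' hM] at h1
      exact (h1 h0).ge
  refine (hle y).antisymm (not_lt.mp fun hy => ?_)
  exact lt_irrefl _ (hasSum_lt hle hy (hasSum_pcond hS hpos)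
    (hasSum_pcond hS (hpos.trans_le (pstr_anti hM s))))

end ConditionalProbabilities

section Concentration

lemma bernoulli_exp_le {q θ : ℝ} (h0 : 0 ≤ q) (h1 : q ≤ 1) (hθ : |θ| ≤ 1) :
    q * Real.exp (θ * (1 - q) - θ ^ 2) + (1 - q) * Real.exp (θ * (0 - q) - θ ^ 2) ≤ 1 := by
  have key {y : ℝ} (hy : |y| ≤ 1) : Real.exp (θ * y) ≤ 1 + θ * y + θ ^ 2 * y ^ 2 := by
    have := (abs_le.mp (Real.abs_exp_sub_one_sub_id_le (x := θ * y) (by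
      rw [abs_mul]; exact mul_le_one₀ hθ (abs_nonneg _) hy))).2
    rw [mul_pow] at this
    linarith
  have hA := key (y := 1 - q) (by rw [abs_le]; constructor <;> linarith)
  have hB := key (y := 0 - q) (by rw [abs_le]; constructor <;> linarith)
  have hE : 1 + θ ^ 2 ≤ Real.exp (θ ^ 2) := by linarith [Real.add_one_le_exp (θ ^ 2)]
  rw [Real.exp_sub, Real.exp_sub, mul_div_assoc', mul_div_assoc', ← add_div,
    div_le_one (Real.exp_pos _)]
  have hA' := mul_le_mul_of_nonneg_left hA h0
  have hB' := mul_le_mul_of_nonneg_left hB (sub_nonneg.mpr h1)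
  have hq : q * (1 - q) ≤ 1 := by nlinarith
  have hq' : θ ^ 2 * (q * (1 - q)) ≤ θ ^ 2 * 1 := by gcongr
  nlinarith

lemma setLIntegral_two_values {Ω : Type*} [MeasurableSpace Ω] {ν : Measure Ω} {f : Ω → ℝ≥0∞}
    {A C : Set Ω} (hA : MeasurableSet A) (hC : MeasurableSet C) {c₁ c₂ : ℝ≥0∞}
    (h1 : ∀ x ∈ C ∩ A, f x = c₁) (h2 : ∀ x ∈ C \ A, f x = c₂) :
    ∫⁻ x in C, f x ∂ν = c₁ * ν (C ∩ A) + c₂ * ν (C \ A) := by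
  rw [← lintegral_inter_add_sdiff f C hA, setLIntegral_congr_fun (hC.inter hA) h1,
    setLIntegral_congr_fun (hC.diff hA) h2, setLIntegral_const, setLIntegral_const]

variable {μ : Measure (Path 𝒳)} {ω ω' : Path 𝒳}

open Classical in
/-- The logarithmic increment at time `T` of the exponential supermartingale which compares the
number of occurrences of the block `ω_{t-m}, …, ω_t` with those of `ω_{t-m}, …, ω_{t-1}`. -/
def logIncr (μ : Measure (Path 𝒳)) (θ : ℝ) (m : ℕ) (t : ℤ) (ω : Path 𝒳) (T : ℤ) : ℝ :=
  if IsMemoryBound μ (word ω (t - 1)) m ∧ OccursAt ω m (word ω (t - 1)) T then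
    θ * ((if ω (T + 1) = ω t then 1 else 0) - pcond μ m (ω t) (word ω (t - 1))) - θ ^ 2
  else 0

/-- The exponential supermartingale with increments `logIncr`, started at time `a`. -/
def expProcess (μ : Measure (Path 𝒳)) (θ : ℝ) (m : ℕ) (t a : ℤ) (k : ℕ) (ω : Path 𝒳) : ℝ :=
  Real.exp (∑ i ∈ Finset.range k, logIncr μ θ m t ω (a + i))

lemma expProcess_succ (μ : Measure (Path 𝒳)) (θ : ℝ) (m : ℕ) (t a : ℤ) (k : ℕ) (ω : Path 𝒳) :
    expProcess μ θ m t a (k + 1) ω =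
      expProcess μ θ m t a k ω * Real.exp (logIncr μ θ m t ω (a + k)) := by
  rw [expProcess, Finset.sum_range_succ, Real.exp_add, expProcess]

/-- The information on which `logIncr` depends, apart from the symbol at time `T + 1`. -/
lemma logIncr_eq_of_agree {θ : ℝ} {m : ℕ} {t T u : ℤ} (htT : t ≤ T) (hT : T ≤ u)
    (h : ∀ i, t - m ≤ i → i ≤ u → ω' i = ω i) :
    logIncr μ θ m t ω' T = open Classical in
      if IsMemoryBound μ (word ω (t - 1)) m ∧ OccursAt ω m (word ω (t - 1)) T then
        θ * ((if ω' (T + 1) = ω t then 1 else 0) - pcond μ m (ω t) (word ω (t - 1))) - θ ^ 2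
      else 0 := by
  have hw : ∀ j < m, word ω' (t - 1) j = word ω (t - 1) j := fun j hj => h _ (by omega) (by omega)
  have ho : OccursAt ω' m (word ω' (t - 1)) T ↔ OccursAt ω m (word ω (t - 1)) T := by
    rw [occursAt_congr hw]
    exact forall₂_congr fun j hj => by rw [h _ (by omega) (by omega)]
  have hp := and_congr (isMemoryBound_congr (μ := μ) hw) ho
  by_cases hQ : IsMemoryBound μ (word ω (t - 1)) m ∧ OccursAt ω m (word ω (t - 1)) T
  · rw [logIncr, if_pos (hp.mpr hQ), if_pos hQ, h t (by omega) (by omega), pcond_congr hw]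
  · rw [logIncr, if_neg (hp.not.mpr hQ), if_neg hQ]

lemma expProcess_eq_of_agree {θ : ℝ} {m : ℕ} {t a : ℤ} (hta : t ≤ a) {k : ℕ}
    (h : ∀ i, t - m ≤ i → i ≤ a + k → ω' i = ω i) :
    expProcess μ θ m t a k ω' = expProcess μ θ m t a k ω := by
  unfold expProcess
  congr 1
  refine Finset.sum_congr rfl fun i hi => ?_
  have hi' := Finset.mem_range.mp hi
  rw [logIncr_eq_of_agree (by omega) (by omega : a + i ≤ a + k) h, logIncr,
    h (a + i + 1) (by omega) (by omega)]

omit [MeasurableSpace 𝒳] in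
lemma agree_of_occursAt_word {M : ℕ} {u v : ℤ} (hM : v - u < M)
    (h : OccursAt ω' M (word ω v) v) : ∀ i, u ≤ i → i ≤ v → ω' i = ω i := by
  intro i h1 h2
  have := h (v - i).toNat (by omega)
  rwa [word, Int.toNat_of_nonneg (by omega), sub_sub_cancel] at this

variable [Countable 𝒳] [MeasurableSingletonClass 𝒳]

lemma measurable_expProcess {θ : ℝ} {m : ℕ} {t a : ℤ} (hta : t ≤ a) (k : ℕ) :
    Measurable (expProcess μ θ m t a k) := by
  intro S _
  refine measurableSet_of_block (a + k - (t - m) + 1).toNat (a + k) fun ω ω' h hω => ?_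
  rw [mem_preimage] at hω ⊢
  rwa [expProcess_eq_of_agree hta (agree_of_occursAt_word (by omega) h)]

variable [IsProbabilityMeasure μ]

lemma lintegral_expProcess_succ_le (hS : MeasurePreserving (shift : Path 𝒳 → Path 𝒳) μ μ)
    {θ : ℝ} (hθ : |θ| ≤ 1) {m : ℕ} {t a : ℤ} (hta : t ≤ a) (k : ℕ) :
    ∫⁻ ω, ENNReal.ofReal (expProcess μ θ m t a (k + 1) ω) ∂μ ≤
      ∫⁻ ω, ENNReal.ofReal (expProcess μ θ m t a k ω) ∂μ := by
  classical
  obtain ⟨M, hM⟩ : ∃ M : ℕ, (M : ℤ) = a + k - (t - m) + 1 :=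
    ⟨(a + k - (t - m) + 1).toNat, Int.toNat_of_nonneg (by omega)⟩
  refine lintegral_le_of_forall_block M (a + k) fun ω₀ => ?_
  set C := {ω : Path 𝒳 | OccursAt ω M (word ω₀ (a + k)) (a + k)} with hCdef
  have hC : MeasurableSet C := measurableSet_occursAt _ _ _
  have hagree : ∀ ω ∈ C, ∀ i, t - m ≤ i → i ≤ a + k → ω i = ω₀ i :=
    fun ω hω => agree_of_occursAt_word (by omega) hω
  have hZ : ∀ ω ∈ C, expProcess μ θ m t a k ω = expProcess μ θ m t a k ω₀ :=
    fun ω hω => expProcess_eq_of_agree hta (hagree ω hω)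
  have hI : ∀ ω ∈ C, logIncr μ θ m t ω (a + k) = _ :=
    fun ω hω => logIncr_eq_of_agree (by omega) le_rfl (hagree ω hω)
  by_cases hc : IsMemoryBound μ (word ω₀ (t - 1)) m ∧ OccursAt ω₀ m (word ω₀ (t - 1)) (a + k)
  swap
  · refine le_of_eq (setLIntegral_congr_fun hC fun ω hω => ?_)
    simp only [expProcess_succ, hI ω hω, if_neg hc, Real.exp_zero, mul_one]
  set q := pcond μ m (ω₀ t) (word ω₀ (t - 1)) with hq
  have hq0 : 0 ≤ q := pcond_nonneg _ _ _ _
  have hq1 : q ≤ 1 := pcond_le_one hS _ _ _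
  set A := {ω : Path 𝒳 | ω (a + k + 1) = ω₀ t} with hAdef
  have hA : MeasurableSet A := measurable_pi_apply _ (measurableSet_singleton _)
  have hCA : μ (C ∩ A) = ENNReal.ofReal q * μ C := by
    have h1 : C ∩ A = {ω | OccursAt ω (M + 1) (withLast (ω₀ t) (word ω₀ (a + k))) (a + k + 1)} := by
      ext ω
      rw [mem_ofPred_eq, occursAt_withLast, add_sub_cancel_right]
      exact and_comm
    rw [h1, measure_occursAt hS, hCdef, measure_occursAt hS, ← ENNReal.ofReal_mul hq0]
    congr 1
    rcases (pstr_nonneg μ M (word ω₀ (a + k))).eq_or_lt with h0 | h0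
    · rw [← h0, mul_zero]
      exact le_antisymm ((pstr_withLast_le hS _ _ _).trans_eq h0.symm) (pstr_nonneg _ _ _)
    · have hw : ∀ j < m, word ω₀ (a + k) j = word ω₀ (t - 1) j := hc.2
      have h2 := ((isMemoryBound_congr hw).mpr hc.1).pcond_eq hS (by omega : m ≤ M) h0 (ω₀ t)
      rw [pcond_congr hw, pcond_eq_div hS M, div_eq_iff h0.ne'] at h2
      exact h2
  have hCA' : μ (C \ A) = ENNReal.ofReal (1 - q) * μ C := by
    have h1 := measure_inter_add_sdiff C hA (μ := μ)
    rw [hCA] at h1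
    have h2 : ENNReal.ofReal q * μ C + ENNReal.ofReal (1 - q) * μ C = μ C := by
      rw [← add_mul, ← ENNReal.ofReal_add hq0 (by linarith)]
      simp
    exact (ENNReal.add_right_inj (ENNReal.mul_ne_top ENNReal.ofReal_ne_top
      (measure_ne_top _ _))).mp (h1.trans h2.symm)
  set z := expProcess μ θ m t a k ω₀ with hz
  have hz0 : 0 ≤ z := (Real.exp_pos _).le
  have hR : ∫⁻ ω in C, ENNReal.ofReal (expProcess μ θ m t a k ω) ∂μ = ENNReal.ofReal z * μ C := by
    rw [setLIntegral_congr_fun hC (g := fun _ => ENNReal.ofReal z)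
      (fun ω hω => by simp only [hZ ω hω]), setLIntegral_const]
  rw [hR, setLIntegral_two_values hA hC (c₁ := ENNReal.ofReal (z * Real.exp (θ * (1 - q) - θ ^ 2)))
      (c₂ := ENNReal.ofReal (z * Real.exp (θ * (0 - q) - θ ^ 2))), hCA, hCA', ← mul_assoc,
      ← mul_assoc, ← add_mul, ← ENNReal.ofReal_mul (by positivity),
      ← ENNReal.ofReal_mul (by positivity), ← ENNReal.ofReal_add]
  · gcongr
    have := mul_le_mul_of_nonneg_left (bernoulli_exp_le hq0 hq1 hθ) hz0
    linarith
  · positivity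
  · exact mul_nonneg (by positivity) (by linarith)
  · intro ω hω
    rw [expProcess_succ, hZ ω hω.1, hI ω hω.1, if_pos hc,
      if_pos (show ω (a + k + 1) = ω₀ t from hω.2)]
  · intro ω hω
    rw [expProcess_succ, hZ ω hω.1, hI ω hω.1, if_pos hc,
      if_neg (show ¬ ω (a + k + 1) = ω₀ t from hω.2)]

lemma lintegral_expProcess_le_one (hS : MeasurePreserving (shift : Path 𝒳 → Path 𝒳) μ μ)
    {θ : ℝ} (hθ : |θ| ≤ 1) {m : ℕ} {t a : ℤ} (hta : t ≤ a) (k : ℕ) :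
    ∫⁻ ω, ENNReal.ofReal (expProcess μ θ m t a k ω) ∂μ ≤ 1 := by
  induction k with
  | zero => simp [expProcess]
  | succ k ih => exact (lintegral_expProcess_succ_le hS hθ hta k).trans ih

lemma measure_expProcess_ge_le (hS : MeasurePreserving (shift : Path 𝒳 → Path 𝒳) μ μ)
    {θ : ℝ} (hθ : |θ| ≤ 1) {m : ℕ} {t a : ℤ} (hta : t ≤ a) (k : ℕ) (r : ℝ) :
    μ {ω | Real.exp r ≤ expProcess μ θ m t a k ω} ≤ ENNReal.ofReal (Real.exp (-r)) := by
  have h := mul_meas_ge_le_lintegral (μ := μ)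
    (measurable_expProcess (μ := μ) (θ := θ) (m := m) hta k).ennreal_ofReal
    (ENNReal.ofReal (Real.exp r))
  have h1 : {ω | Real.exp r ≤ expProcess μ θ m t a k ω} ⊆
      {ω | ENNReal.ofReal (Real.exp r) ≤ ENNReal.ofReal (expProcess μ θ m t a k ω)} :=
    fun ω hω => ENNReal.ofReal_le_ofReal hω
  rw [Real.exp_neg, ENNReal.ofReal_inv_of_pos (Real.exp_pos r), ← one_div,
    ENNReal.le_div_iff_mul_le (by simp [Real.exp_pos]) (by simp), mul_comm]
  refine le_trans ?_ (h.trans (lintegral_expProcess_le_one hS hθ hta k))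
  gcongr

end Concentration

section EmpiricalDeviations

variable {ω : Path 𝒳} {m : ℕ} {s : ℕ → 𝒳} {a b : ℤ}

omit [MeasurableSpace 𝒳] in
open Classical in
lemma cnt_withLast_le (ω : Path 𝒳) (m : ℕ) (x : 𝒳) (s : ℕ → 𝒳) (a b : ℤ) :
    cnt ω (m + 1) (withLast x s) (a + 1) b ≤ cnt ω m s a (b - 1) := by
  refine Finset.card_le_card_of_injOn (fun t => t - 1) (fun t ht => ?_)
    (fun t _ t' _ h => sub_left_injective h)
  simp only [Finset.coe_filter, Finset.mem_Icc, mem_ofPred_eq] at ht ⊢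
  exact ⟨by omega, (occursAt_withLast.mp ht.2).2⟩

lemma sum_logIncr {μ : Measure (Path 𝒳)} {θ : ℝ} {t : ℤ}
    (h : IsMemoryBound μ (word ω (t - 1)) m) (a : ℤ) (k : ℕ) :
    ∑ i ∈ Finset.range k, logIncr μ θ m t ω (a + i) =
      θ * (cnt ω (m + 1) (word ω t) (a + 1) (a + k) -
        pcond μ m (ω t) (word ω (t - 1)) * cnt ω m (word ω (t - 1)) a (a + k - 1)) -
      θ ^ 2 * cnt ω m (word ω (t - 1)) a (a + k - 1) := by
  classical
  induction k with
  | zero => simp [cnt_of_lt]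
  | succ k ih =>
    have h1 := cnt_add_one (ω := ω) (m := m) (s := word ω (t - 1)) (a := a) (b := a + k - 1)
      (by omega)
    have h2 := cnt_add_one (ω := ω) (m := m + 1) (s := word ω t) (a := a + 1) (b := a + k)
      (by omega)
    have h3 : OccursAt ω (m + 1) (word ω t) (a + k + 1) ↔
        ω (a + k + 1) = ω t ∧ OccursAt ω m (word ω (t - 1)) (a + k) := by
      rw [← withLast_word, occursAt_withLast, add_sub_cancel_right]
    rw [sub_add_cancel] at h1
    have e1 : a + ((k + 1 : ℕ) : ℤ) - 1 = a + k := by push_cast; ring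
    have e2 : a + ((k + 1 : ℕ) : ℤ) = a + k + 1 := by push_cast; ring
    rw [Finset.sum_range_succ, ih, e1, e2, h1, h2, logIncr]
    by_cases ho : OccursAt ω m (word ω (t - 1)) (a + k)
    · by_cases hx : ω (a + k + 1) = ω t
      · rw [if_pos ⟨h, ho⟩, if_pos ho, if_pos (h3.mpr ⟨hx, ho⟩), if_pos hx]
        push_cast
        ring
      · rw [if_pos ⟨h, ho⟩, if_pos ho, if_neg (fun h' => hx (h3.mp h').1), if_neg hx]
        push_cast
        ring
    · rw [if_neg (fun h' => ho h'.2), if_neg ho, if_neg (fun h' => ho (h3.mp h').2)]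
      push_cast
      ring

lemma exists_sign_of_deviation {C N q ε R : ℝ} (hε : 0 ≤ ε) (hR : 0 ≤ R) (hC : R < C)
    (hN : C ≤ N) (h : ε < |C / N - q|) :
    ε ^ 2 * R / 4 ≤ (ε / 2) * (C - q * N) - (ε / 2) ^ 2 * N ∨
      ε ^ 2 * R / 4 ≤ (-(ε / 2)) * (C - q * N) - (-(ε / 2)) ^ 2 * N := by
  have hN0 : 0 < N := by linarith
  have hdiv : C / N - q = (C - q * N) / N := by field_simp
  rw [hdiv, abs_div, abs_of_pos hN0, lt_div_iff₀ hN0] at h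
  have hRN : ε ^ 2 * R ≤ ε ^ 2 * N := by gcongr; linarith
  rcases abs_cases (C - q * N) with ⟨h1, -⟩ | ⟨h1, -⟩ <;> rw [h1] at h
  · left
    nlinarith [mul_le_mul_of_nonneg_left h.le hε]
  · right
    nlinarith [mul_le_mul_of_nonneg_left h.le hε]

variable [Countable 𝒳] [MeasurableSingletonClass 𝒳] {μ : Measure (Path 𝒳)}
  [IsProbabilityMeasure μ]

lemma measure_deviation_le (hS : MeasurePreserving (shift : Path 𝒳 → Path 𝒳) μ μ) {t n : ℤ}
    (hta : t ≤ a) (m : ℕ) {ε R : ℝ} (hε0 : 0 ≤ ε) (hε1 : ε ≤ 1) (hR : 0 ≤ R) :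
    μ {ω | IsMemoryBound μ (word ω (t - 1)) m ∧
        R < cnt ω (m + 1) (word ω t) (a + 1) n ∧
        ε < |(cnt ω (m + 1) (word ω t) (a + 1) n : ℝ) / cnt ω m (word ω (t - 1)) a (n - 1) -
          pcond μ m (ω t) (word ω (t - 1))|} ≤
      2 * ENNReal.ofReal (Real.exp (-(ε ^ 2 * R / 4))) := by
  have hθ : |ε / 2| ≤ 1 := by rw [abs_of_nonneg (by positivity)]; linarith
  rw [two_mul]
  refine le_trans (measure_mono ?_) ((measure_union_le _ _).trans (add_le_add
    (measure_expProcess_ge_le hS hθ (m := m) hta (n - a).toNat _)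
    (measure_expProcess_ge_le hS ((abs_neg (ε / 2)).trans_le hθ) (m := m) hta (n - a).toNat _)))
  rintro ω ⟨hmb, hC, hdev⟩
  have hN := cnt_withLast_le ω m (ω t) (word ω (t - 1)) a n
  rw [withLast_word] at hN
  have han : a + ((n - a).toNat : ℤ) = n := by
    rw [Int.toNat_of_nonneg, add_sub_cancel]
    by_contra! hlt
    rw [cnt_of_lt (by omega), Nat.cast_zero] at hC
    linarith
  refine (exists_sign_of_deviation hε0 hR hC (by exact_mod_cast hN) hdev).imp ?_ ?_ <;>
  · intro h
    rw [mem_ofPred_eq, expProcess, sum_logIncr hmb, han]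
    exact Real.exp_le_exp.mpr h

lemma summable_sq_mul_exp_neg_rpow {α c : ℝ} (hα : 0 < α) (hc : 0 < c) :
    Summable fun n : ℕ => (n : ℝ) ^ 2 * Real.exp (-(c * (n : ℝ) ^ α)) := by
  have h1 : (fun n : ℕ => Real.exp (-c * ((n : ℝ) ^ α))) =o[atTop]
      fun n : ℕ => ((n : ℝ) ^ α) ^ (-4 / α) :=
    (isLittleO_exp_neg_mul_rpow_atTop hc (-4 / α)).comp_tendsto
      ((tendsto_rpow_atTop hα).comp tendsto_natCast_atTop_atTop)
  refine summable_of_isBigO_nat (Real.summable_nat_pow_inv.mpr (one_lt_two)) ?_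
  refine ((Asymptotics.isBigO_refl (fun n : ℕ => (n : ℝ) ^ 2) atTop).mul h1.isBigO).congr'
    (Eventually.of_forall fun n => by simp only [neg_mul]) ?_
  filter_upwards [eventually_gt_atTop 0] with n hn
  have hn' : (0 : ℝ) < n := by exact_mod_cast hn
  rw [← Real.rpow_mul hn'.le, mul_div_cancel₀ _ hα.ne', Real.rpow_neg hn'.le]
  norm_cast
  field_simp
  push_cast
  ring

/-- Almost surely, for all large `n` the empirical conditional frequencies given words which
determine the conditional distribution are uniformly close to the true ones. -/
lemma ae_eventually_abs_empCond_sub_pcond_le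
    (hS : MeasurePreserving (shift : Path 𝒳 → Path 𝒳) μ μ) {β γ : ℝ} (hβ : 0 < β)
    (hβγ : 2 * β + γ < 1) :
    ∀ᵐ ω ∂μ, ∀ᶠ n : ℕ in atTop, ∀ (m : ℕ) (x : 𝒳) (s : ℕ → 𝒳), IsMemoryBound μ s m →
      inL γ ω n m (withLast x s) →
      |empCond ω n m x s - pcond μ m x s| ≤ (n : ℝ) ^ (-β) / 2 := by
  set bad : ℕ → ℕ → ℕ → Set (Path 𝒳) := fun n m t =>
    if t < half n then
      {ω | IsMemoryBound μ (word ω ((t : ℤ) - 1)) m ∧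
        (n : ℝ) ^ (1 - γ) < cnt ω (m + 1) (word ω t) (((half n : ℤ) + m - 1) + 1) n ∧
        (n : ℝ) ^ (-β) / 2 <
          |(cnt ω (m + 1) (word ω t) (((half n : ℤ) + m - 1) + 1) n : ℝ) /
            cnt ω m (word ω ((t : ℤ) - 1)) ((half n : ℤ) + m - 1) ((n : ℤ) - 1) -
          pcond μ m (ω t) (word ω ((t : ℤ) - 1))|}
    else ∅ with hbad
  have hexp (n : ℕ) (hn : 0 < n) : ((n : ℝ) ^ (-β) / 2) ^ 2 * (n : ℝ) ^ (1 - γ) / 4 =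
      1 / 16 * (n : ℝ) ^ (1 - γ - 2 * β) := by
    have hn' : (0 : ℝ) < n := by exact_mod_cast hn
    rw [show 1 - γ - 2 * β = -β + -β + (1 - γ) by ring, Real.rpow_add hn', Real.rpow_add hn']
    ring
  have hbound (n m t : ℕ) (hn : 0 < n) :
      μ (bad n m t) ≤ 2 * ENNReal.ofReal (Real.exp (-(1 / 16 * (n : ℝ) ^ (1 - γ - 2 * β)))) := by
    simp only [hbad]
    split_ifs with ht
    · have h1 : (n : ℝ) ^ (-β) ≤ 1 :=
        Real.rpow_le_one_of_one_le_of_nonpos (by exact_mod_cast hn) (by linarith)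
      have h2 : (0 : ℝ) ≤ (n : ℝ) ^ (-β) := by positivity
      rw [← hexp n hn]
      exact measure_deviation_le hS (by omega) m (by linarith) (by linarith) (by positivity)
    · simp
  have hunion (n : ℕ) (hn : 0 < n) :
      μ (⋃ p ∈ Finset.range n ×ˢ Finset.range n, bad n p.1 p.2) ≤
        ENNReal.ofReal (2 * ((n : ℝ) ^ 2 * Real.exp (-(1 / 16 * (n : ℝ) ^ (1 - γ - 2 * β))))) := by
    refine (measure_biUnion_finset_le _ _).trans
      ((Finset.sum_le_card_nsmul _ _ _ fun p _ => hbound n p.1 p.2 hn).trans_eq ?_)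
    rw [Finset.card_product, Finset.card_range, nsmul_eq_mul, ENNReal.ofReal_mul two_pos.le,
      ENNReal.ofReal_mul (by positivity)]
    rw [ENNReal.ofReal_ofNat, ENNReal.ofReal_pow (Nat.cast_nonneg n), ENNReal.ofReal_natCast]
    push_cast
    ring
  have hsum : ∑' n, μ (⋃ p ∈ Finset.range n ×ˢ Finset.range n, bad n p.1 p.2) ≠ ∞ := by
    refine ne_top_of_le_ne_top (Summable.tsum_ofReal_ne_top
      ((summable_sq_mul_exp_neg_rpow (α := 1 - γ - 2 * β) (c := 1 / 16) (by linarith)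
        (by norm_num)).mul_left 2)) (ENNReal.tsum_le_tsum fun n => ?_)
    rcases n.eq_zero_or_pos with rfl | hn
    · simp
    · exact hunion n hn
  filter_upwards [ae_eventually_notMem hsum] with ω hω
  filter_upwards [hω] with n hn m x s hmb hL
  by_contra! hdev
  obtain ⟨⟨t, hmt, hth, hocc⟩, h2⟩ := hL
  have ht0 : ((t.toNat : ℕ) : ℤ) = t := Int.toNat_of_nonneg (by omega)
  have hx := (occursAt_withLast.mp hocc).1
  have hw : ∀ j < m, s j = word ω (t - 1) j := fun j hj =>
    ((occursAt_withLast.mp hocc).2 j hj).symm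
  have hw' : ∀ j < m + 1, withLast x s j = word ω t j := fun j hj => (hocc j hj).symm
  refine hn (mem_iUnion₂.mpr ⟨(m, t.toNat), ?_, ?_⟩)
  · simp only [Finset.mem_product, Finset.mem_range]
    simp only [half] at hth
    omega
  · simp only [hbad]
    rw [if_pos (by omega)]
    simp only [mem_ofPred_eq, ht0, sub_add_cancel]
    rw [inL2, cnt_congr hw'] at h2
    rw [empCond, cnt_congr hw', cnt_congr hw, pcond_congr hw, ← hx] at hdev
    exact ⟨(isMemoryBound_congr hw).mp hmb, h2, hdev⟩

end EmpiricalDeviations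

section Consistency

variable {μ : Measure (Path 𝒳)} {ω : Path 𝒳} {m : ℕ} {s : ℕ → 𝒳}

lemma tendsto_half_div : Tendsto (fun n : ℕ => (half n : ℝ) / n) atTop (𝓝 (1 / 2)) := by
  have h1 : Tendsto (fun n : ℕ => (1 / 2 : ℝ) + 1 / (n : ℝ)) atTop (𝓝 (1 / 2)) := by
    simpa using (tendsto_const_nhds (x := (1 / 2 : ℝ))).add
      (tendsto_one_div_atTop_nhds_zero_nat (𝕜 := ℝ))
  refine tendsto_of_tendsto_of_tendsto_of_le_of_le' tendsto_const_nhds h1 ?_ ?_ <;>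
    filter_upwards [eventually_gt_atTop 0] with n hn
  · have hn' : (0 : ℝ) < n := by exact_mod_cast hn
    have : n ≤ 2 * half n := by simp only [half]; omega
    have : (n : ℝ) ≤ 2 * half n := by exact_mod_cast this
    rw [le_div_iff₀ hn']
    linarith
  · have hn' : (0 : ℝ) < n := by exact_mod_cast hn
    have : 2 * half n ≤ n + 1 := by simp only [half]; omega
    have : 2 * (half n : ℝ) ≤ n + 1 := by exact_mod_cast this
    rw [div_le_iff₀ hn', add_mul, one_div_mul_cancel hn'.ne']
    linarith

lemma tendsto_half_add (c : ℤ) : Tendsto (fun n : ℕ => (half n : ℤ) + c) atTop atTop := by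
  refine tendsto_atTop_add_const_right _ _ (tendsto_natCast_atTop_atTop.comp
    (tendsto_atTop.mpr fun k => ?_))
  filter_upwards [eventually_ge_atTop (2 * k)] with n hn
  simp only [half]
  omega

omit [MeasurableSpace 𝒳] in
lemma tendsto_cnt_div_of_tendsto {p ρ : ℝ}
    (hfreq : Tendsto (fun n : ℕ => (cnt ω m s 0 ((n : ℤ) - 1) : ℝ) / n) atTop (𝓝 p))
    {v : ℕ → ℤ} (hv : Tendsto v atTop atTop)
    (hρ : Tendsto (fun n => (v n : ℝ) / n) atTop (𝓝 ρ)) :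
    Tendsto (fun n : ℕ => (cnt ω m s 0 (v n - 1) : ℝ) / n) atTop (𝓝 (ρ * p)) := by
  have hv' : Tendsto (fun n => (v n).toNat) atTop atTop :=
    tendsto_atTop.mpr fun k => by
      filter_upwards [hv.eventually_ge_atTop (k : ℤ)] with n hn
      omega
  refine (hρ.mul (hfreq.comp hv')).congr' ?_
  filter_upwards [hv.eventually_gt_atTop 0] with n hn
  have h1 : (((v n).toNat : ℕ) : ℤ) = v n := Int.toNat_of_nonneg hn.le
  have h2 : (((v n).toNat : ℕ) : ℝ) = v n := by exact_mod_cast h1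
  have h3 : (v n : ℝ) ≠ 0 := by exact_mod_cast hn.ne'
  simp only [Function.comp_apply, h1, h2]
  field_simp

omit [MeasurableSpace 𝒳] in
lemma tendsto_cnt_half_div {p : ℝ}
    (hfreq : Tendsto (fun n : ℕ => (cnt ω m s 0 ((n : ℤ) - 1) : ℝ) / n) atTop (𝓝 p)) (c d : ℤ) :
    Tendsto (fun n : ℕ => (cnt ω m s ((half n : ℤ) + c) ((n : ℤ) + d) : ℝ) / n) atTop
      (𝓝 (p / 2)) := by
  have hc (e : ℤ) : Tendsto (fun n : ℕ => (e : ℝ) / n) atTop (𝓝 0) :=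
    tendsto_const_div_atTop_nhds_zero_nat _
  have h1 := tendsto_cnt_div_of_tendsto hfreq (ρ := 1) (v := fun n => (n : ℤ) + (d + 1))
    (tendsto_atTop_add_const_right _ _ tendsto_natCast_atTop_atTop) (by
      have := (tendsto_const_nhds (x := (1 : ℝ))).add (hc (d + 1))
      rw [add_zero] at this
      refine this.congr' ?_
      filter_upwards [eventually_gt_atTop 0] with n hn
      have hn' : (n : ℝ) ≠ 0 := by positivity
      push_cast
      field_simp)
  have h2 := tendsto_cnt_div_of_tendsto hfreq (ρ := 1 / 2) (tendsto_half_add c) (by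
      have := tendsto_half_div.add (hc c)
      rw [add_zero] at this
      refine this.congr fun n => ?_
      push_cast
      rw [add_div])
  have h3 := h1.sub h2
  rw [show 1 * p - 1 / 2 * p = p / 2 by ring] at h3
  refine h3.congr' ?_
  have hgap : ∀ᶠ n : ℕ in atTop, (half n : ℤ) + c ≤ (n : ℤ) + d := by
    filter_upwards [eventually_ge_atTop (2 * (c - d).toNat + 1)] with n hn
    simp only [half]
    omega
  filter_upwards [hgap, (tendsto_half_add c).eventually_ge_atTop 0] with n hn hn'
  have h4 := cnt_add (ω := ω) (m := m) (s := s) (a := 0) (b := (half n : ℤ) + c - 1)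
    (c := (n : ℤ) + d) (by omega) (by omega)
  rw [sub_add_cancel] at h4
  rw [← sub_div, show (n : ℤ) + (d + 1) - 1 = n + d by ring, ← h4]
  push_cast
  ring

omit [MeasurableSpace 𝒳] in
lemma empCond_nonneg (ω : Path 𝒳) (n m : ℕ) (x : 𝒳) (s : ℕ → 𝒳) : 0 ≤ empCond ω n m x s := by
  unfold empCond; positivity

omit [MeasurableSpace 𝒳] in
lemma empCond_le_one (ω : Path 𝒳) (n m : ℕ) (x : 𝒳) (s : ℕ → 𝒳) : empCond ω n m x s ≤ 1 := by
  have := cnt_withLast_le ω m x s ((half n : ℤ) + m - 1) n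
  rw [sub_add_cancel] at this
  exact div_le_one_of_le₀ (by exact_mod_cast this) (by positivity)

lemma eventually_inL {γ : ℝ} (hγ : 0 < γ)
    (hfreq : Tendsto (fun n : ℕ => (cnt ω (m + 1) s 0 ((n : ℤ) - 1) : ℝ) / n) atTop
      (𝓝 (pstr μ (m + 1) s)))
    (hpos : 0 < pstr μ (m + 1) s) : ∀ᶠ n : ℕ in atTop, inL γ ω n m s := by
  obtain ⟨t, ht, hocc⟩ := exists_occursAt_gt hfreq hpos m
  have hsmall : Tendsto (fun n : ℕ => (n : ℝ) ^ (-γ)) atTop (𝓝 0) :=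
    (tendsto_rpow_neg_atTop hγ).comp tendsto_natCast_atTop_atTop
  filter_upwards [(tendsto_half_add (-1)).eventually_ge_atTop t, eventually_gt_atTop 0,
    hsmall.eventually_lt (tendsto_cnt_half_div hfreq m 0) (half_pos hpos)] with n h1 h2 h3
  refine ⟨⟨t, ht.le, h1, hocc⟩, ?_⟩
  have hn : (0 : ℝ) < n := by exact_mod_cast h2
  rw [lt_div_iff₀ hn, add_zero] at h3
  rwa [inL2, sub_eq_neg_add, Real.rpow_add hn, Real.rpow_one]

section Convergence

variable [MeasurableSingletonClass 𝒳] [IsFiniteMeasure μ]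

lemma tendsto_empCond (hS : MeasurePreserving (shift : Path 𝒳 → Path 𝒳) μ μ)
    (hfreq : ∀ (m : ℕ) (s : ℕ → 𝒳), Tendsto (fun n : ℕ =>
      (cnt ω m s 0 ((n : ℤ) - 1) : ℝ) / n) atTop (𝓝 (pstr μ m s)))
    (hpos : 0 < pstr μ m s) (x : 𝒳) :
    Tendsto (fun n => empCond ω n m x s) atTop (𝓝 (pcond μ m x s)) := by
  have h := (tendsto_cnt_half_div (hfreq (m + 1) (withLast x s)) m 0).div
    (tendsto_cnt_half_div (hfreq m s) (m - 1) (-1)) (half_pos hpos).ne'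
  rw [div_div_div_cancel_right₀ two_ne_zero, ← pcond_eq_div hS] at h
  refine h.congr' ?_
  filter_upwards [eventually_gt_atTop 0] with n hn
  have hn' : (n : ℝ) ≠ 0 := by positivity
  rw [Pi.div_apply, div_div_div_cancel_right₀ hn', empCond, add_zero, ← add_sub_assoc,
    ← sub_eq_add_neg]

variable {β γ : ℝ} {l : ℕ → ℕ} {k : ℕ}

lemma eventually_lt_hatDelta (hS : MeasurePreserving (shift : Path 𝒳 → Path 𝒳) μ μ)
    (hfreq : ∀ (m : ℕ) (s : ℕ → 𝒳), Tendsto (fun n : ℕ =>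
      (cnt ω m s 0 ((n : ℤ) - 1) : ℝ) / n) atTop (𝓝 (pstr μ m s)))
    (hβ : 0 < β) (hγ : 0 < γ) (hk : ¬ IsMemoryBound μ (tildePast l ω) k) :
    ∀ᶠ n : ℕ in atTop, (n : ℝ) ^ (-β) < hatDelta γ l ω n k := by
  simp only [IsMemoryBound, not_forall] at hk
  obtain ⟨i, hi, y, z, hpos, hne⟩ := hk
  set b := tildePast l ω with hb
  have hpos1 : 0 < pstr μ (k + i) (prependOld b k z) :=
    hpos.trans_le (pstr_withLast_le hS _ _ _)
  have hpos2 : 0 < pstr μ k b := by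
    rw [← pstr_congr (s := prependOld b k z) fun j hj => prependOld_of_lt hj b z]
    exact hpos1.trans_le (pstr_anti (Nat.le_add_right k i) _)
  have hlim := ((tendsto_empCond hS hfreq hpos2 y).sub (tendsto_empCond hS hfreq hpos1 y)).abs
  have hsmall : Tendsto (fun n : ℕ => (n : ℝ) ^ (-β)) atTop (𝓝 0) :=
    (tendsto_rpow_neg_atTop hβ).comp tendsto_natCast_atTop_atTop
  filter_upwards [hsmall.eventually_lt hlim (abs_pos.mpr (sub_ne_zero.mpr hne)),
    eventually_inL hγ (hfreq _ _) hpos, eventually_ge_atTop i,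
    (tendsto_half_add (-1)).eventually_ge_atTop (zeta l ω (Jfun l k))] with n h1 h2 h3 h4
  rw [hatDelta, if_pos (by omega), one_mul]
  refine h1.trans_le (le_csSup ⟨1, ?_⟩ ⟨i, hi, h3, z, y, h2, rfl⟩)
  rintro _ ⟨i', -, -, z', x', -, rfl⟩
  exact abs_sub_le_of_nonneg_of_le (empCond_nonneg _ _ _ _ _) (empCond_le_one _ _ _ _ _)
    (empCond_nonneg _ _ _ _ _) (empCond_le_one _ _ _ _ _)

omit [MeasurableSpace 𝒳] in
lemma inL_of_prependOld {n i : ℕ} {b z : ℕ → 𝒳} {x : 𝒳}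
    (h : inL γ ω n (k + i) (withLast x (prependOld b k z))) : inL γ ω n k (withLast x b) := by
  classical
  have hocc {t : ℤ} (ht : OccursAt ω (k + i + 1) (withLast x (prependOld b k z)) t) :
      OccursAt ω (k + 1) (withLast x b) t :=
    (occursAt_congr (withLast_congr fun j hj => prependOld_of_lt hj b z)).mp
      (ht.mono (by omega))
  obtain ⟨⟨t, h1, h2, h3⟩, h4⟩ := h
  refine ⟨⟨t, by omega, h2, hocc h3⟩, h4.trans_le (Nat.cast_le.mpr ?_)⟩
  refine le_trans (Finset.card_le_card ?_) (cnt_mono (a := (half n : ℤ) + (k + i : ℕ)) (by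
    push_cast; omega) le_rfl)
  exact Finset.monotone_filter_right _ fun t _ ht => hocc ht

omit [MeasurableSingletonClass 𝒳] in
lemma eventually_hatDelta_le (hpos : ∀ (m : ℕ) (t : ℤ), 0 < pstr μ m (word ω t))
    (hconc : ∀ᶠ n : ℕ in atTop, ∀ (m : ℕ) (x : 𝒳) (s : ℕ → 𝒳), IsMemoryBound μ s m →
      inL γ ω n m (withLast x s) → |empCond ω n m x s - pcond μ m x s| ≤ (n : ℝ) ^ (-β) / 2)
    (hk : IsMemoryBound μ (tildePast l ω) k) :
    ∀ᶠ n : ℕ in atTop, hatDelta γ l ω n k ≤ (n : ℝ) ^ (-β) := by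
  filter_upwards [hconc] with n hn
  have h0 : (0 : ℝ) ≤ (n : ℝ) ^ (-β) := by positivity
  set b := tildePast l ω with hb
  have hle : sSup {d : ℝ | ∃ i : ℕ, 1 ≤ i ∧ i ≤ n ∧ ∃ z : ℕ → 𝒳, ∃ x : 𝒳,
      inL γ ω n (k + i) (withLast x (prependOld b k z)) ∧
      d = |empCond ω n k x b - empCond ω n (k + i) x (prependOld b k z)|} ≤ (n : ℝ) ^ (-β) := by
    refine Real.sSup_le ?_ h0
    rintro _ ⟨i, hi, -, z, x, hL, rfl⟩
    obtain ⟨t, -, -, ht⟩ := hL.1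
    have heq := hk i hi x z (by
      rw [pstr_congr (s' := word ω t) fun j hj => (ht j hj).symm]
      exact hpos _ _)
    have h1 := abs_le.mp (hn k x b hk (inL_of_prependOld hL))
    have h2 := abs_le.mp (hn (k + i) x _ (hk.prepend i z) hL)
    rw [← heq] at h2
    rw [abs_le]
    constructor <;> linarith [h1.1, h1.2, h2.1, h2.2]
  rw [hatDelta]
  split_ifs
  · rwa [one_mul]
  · rwa [zero_mul]

/-- The order estimates are eventually equal to the memory length. -/
lemma eventually_chi_eq (hS : MeasurePreserving (shift : Path 𝒳 → Path 𝒳) μ μ)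
    (hfreq : ∀ (m : ℕ) (s : ℕ → 𝒳), Tendsto (fun n : ℕ =>
      (cnt ω m s 0 ((n : ℤ) - 1) : ℝ) / n) atTop (𝓝 (pstr μ m s)))
    (hpos : ∀ (m : ℕ) (t : ℤ), 0 < pstr μ m (word ω t)) (hβ : 0 < β) (hγ : 0 < γ)
    (hconc : ∀ᶠ n : ℕ in atTop, ∀ (m : ℕ) (x : 𝒳) (s : ℕ → 𝒳), IsMemoryBound μ s m →
      inL γ ω n m (withLast x s) → |empCond ω n m x s - pcond μ m x s| ≤ (n : ℝ) ^ (-β) / 2)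
    (hmem : memLen μ (tildePast l ω) ≠ ⊤) :
    ∀ᶠ n : ℕ in atTop, chi β γ l ω n = (memLen μ (tildePast l ω)).toNat := by
  set K := (memLen μ (tildePast l ω)).toNat with hK
  have hlt : ∀ᶠ n : ℕ in atTop, ∀ k ∈ Finset.range K, (n : ℝ) ^ (-β) < hatDelta γ l ω n k :=
    (Finset.eventually_all _).mpr fun k hk => eventually_lt_hatDelta hS hfreq hβ hγ fun h =>
      (toNat_memLen_le h).not_gt (Finset.mem_range.mp hk)
  filter_upwards [hlt, eventually_hatDelta_le hpos hconc (isMemoryBound_toNat_memLen hmem),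
    eventually_gt_atTop K] with n h1 h2 h3
  have hKmem : K ∈ {k : ℕ | k < n ∧ hatDelta γ l ω n k ≤ (n : ℝ) ^ (-β)} := ⟨h3, h2⟩
  refine (Nat.sInf_le hKmem).antisymm (le_csInf ⟨K, hKmem⟩ fun k hk => ?_)
  by_contra! hlt'
  exact (h1 k (Finset.mem_range.mpr hlt')).not_ge hk.2

end Convergence

end Consistency

section StoppingTimes

variable {ω : Path 𝒳} {β γ : ℝ} {l : ℕ → ℕ}

omit [MeasurableSpace 𝒳]

lemma lambda_add_one_le (β γ : ℝ) (l : ℕ → ℕ) (ω : Path 𝒳) (n : ℕ) :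
    lambda β γ l ω n + 1 ≤ lambda β γ l ω (n + 1) := by
  rw [lambda]
  omega

lemma natCast_le_lambda (β γ : ℝ) (l : ℕ → ℕ) (ω : Path 𝒳) (n : ℕ) :
    (n : ℤ) ≤ lambda β γ l ω n := by
  induction n with
  | zero => exact le_rfl
  | succ n ih =>
    have := lambda_add_one_le β γ l ω n
    push_cast
    omega

lemma tendsto_lambda (β γ : ℝ) (l : ℕ → ℕ) (ω : Path 𝒳) : Tendsto (lambda β γ l ω) atTop atTop :=
  tendsto_atTop_mono (natCast_le_lambda β γ l ω) tendsto_natCast_atTop_atTop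

lemma zeta_strictMono (hrec : ∀ (m : ℕ) (t a : ℤ), ∃ t' > a, OccursAt ω m (word ω t) t')
    (l : ℕ → ℕ) : StrictMono (zeta l ω) :=
  strictMono_nat_of_lt_succ fun n => (zeta_succ_spec hrec l n).1

lemma le_jIndex (hrec : ∀ (m : ℕ) (t a : ℤ), ∃ t' > a, OccursAt ω m (word ω t) t')
    {J : ℕ} {v : ℤ} (hv : zeta l ω J ≤ v) : J ≤ jIndex l ω v := by
  have hz := zeta_strictMono hrec l
  obtain ⟨j, hj⟩ : ∃ j, v < zeta l ω j := by
    refine ⟨J + (v - zeta l ω J).toNat + 1, ?_⟩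
    have (i : ℕ) : zeta l ω J + i ≤ zeta l ω (J + i) := by
      induction i with
      | zero => simp
      | succ i ih =>
        have := hz (Nat.lt_succ_self (J + i))
        push_cast
        rw [← add_assoc J]
        simp only [Nat.succ_eq_add_one] at this
        omega
    have := this ((v - zeta l ω J).toNat + 1)
    rw [← add_assoc] at this
    omega
  refine le_csInf ⟨j, hj.trans (hz (Nat.lt_succ_self j))⟩ fun i hi => ?_
  by_contra! hlt
  exact (hi.trans_le (hz.monotone (Nat.succ_le_of_lt hlt))).not_ge hv

/-- Once the order estimate has settled at `K`, the stopping times `λ_n` run through the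
consecutive occurrences of the last `K` symbols of the limiting past. -/
lemma eventually_cnt_lambda_succ
    (hrec : ∀ (m : ℕ) (t a : ℤ), ∃ t' > a, OccursAt ω m (word ω t) t')
    (hlmono : Monotone l) (hltop : Tendsto l atTop atTop) {K : ℕ}
    (hchi : ∀ᶠ n : ℕ in atTop, chi β γ l ω n = K) :
    ∀ᶠ n : ℕ in atTop, cnt ω K (tildePast l ω) 0 (lambda β γ l ω (n + 1)) =
      cnt ω K (tildePast l ω) 0 (lambda β γ l ω n) + 1 := by
  classical
  set b := tildePast l ω with hb
  have hagree {j : ℕ} (hj : Jfun l K ≤ j) : ∀ r < K, word ω (zeta l ω j) r = b r :=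
    fun r hr => word_zeta_eq_tildePast hrec hlmono hltop hj hr.le
  obtain ⟨N, hN⟩ := eventually_atTop.mp hchi
  filter_upwards [eventually_ge_atTop N,
    (tendsto_lambda β γ l ω).eventually_ge_atTop (zeta l ω (Jfun l K))] with n hn hz
  set v := lambda β γ l ω n with hv
  have hnv : (n : ℤ) ≤ v := natCast_le_lambda β γ l ω n
  have hset : {s : ℕ | ∀ r < chi β γ l ω (v + 1 + (s : ℤ)).toNat,
      ω (v + 1 + (s : ℤ) - (r : ℤ)) = ω (zeta l ω (jIndex l ω v) - (r : ℤ))} =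
      {s : ℕ | OccursAt ω K b (v + 1 + s)} := by
    ext s
    rw [mem_ofPred_eq, mem_ofPred_eq, hN _ (by omega)]
    exact occursAt_congr (hagree (le_jIndex hrec hz))
  have hsucc : lambda β γ l ω (n + 1) =
      v + 1 + ((sInf {s : ℕ | OccursAt ω K b (v + 1 + s)} : ℕ) : ℤ) := by
    rw [lambda, hset]
  set u := sInf {s : ℕ | OccursAt ω K b (v + 1 + s)} with hu
  have hocc : OccursAt ω K b (v + 1 + u) := by
    have hne : {s : ℕ | OccursAt ω K b (v + 1 + s)}.Nonempty := by
      obtain ⟨t, ht, h⟩ := hrec K (zeta l ω (Jfun l K)) v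
      refine ⟨(t - (v + 1)).toNat, ?_⟩
      rw [mem_ofPred_eq, Int.toNat_of_nonneg (by omega), add_sub_cancel]
      exact (occursAt_congr (hagree le_rfl)).mp h
    exact Nat.sInf_mem hne
  have hno : cnt ω K b (v + 1) (v + u) = 0 := by
    rw [cnt, Finset.card_eq_zero, Finset.filter_eq_empty_iff]
    intro t ht h
    rw [Finset.mem_Icc] at ht
    have : (t - (v + 1)).toNat ∈ {s : ℕ | OccursAt ω K b (v + 1 + s)} := by
      rwa [mem_ofPred_eq, Int.toNat_of_nonneg (by omega), add_sub_cancel]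
    have := Nat.sInf_le this
    omega
  have h1 := cnt_add (ω := ω) (m := K) (s := b) (a := 0) (b := v) (c := v + u) (by omega)
    (by omega)
  have h2 := cnt_add_one (ω := ω) (m := K) (s := b) (a := 0) (b := v + u) (by omega)
  rw [show v + u + 1 = v + 1 + u by ring, if_pos hocc, ← h1, hno, add_zero] at h2
  rw [hsucc, h2]

lemma tendsto_lambda_div {p : ℝ} (hp : 0 < p) {K : ℕ} {b : ℕ → 𝒳}
    (hfreq : Tendsto (fun n : ℕ => (cnt ω K b 0 ((n : ℤ) - 1) : ℝ) / n) atTop (𝓝 p))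
    (hcnt : ∀ᶠ n : ℕ in atTop,
      cnt ω K b 0 (lambda β γ l ω (n + 1)) = cnt ω K b 0 (lambda β γ l ω n) + 1) :
    Tendsto (fun n => (lambda β γ l ω n : ℝ) / (n : ℝ)) atTop (𝓝 (1 / p)) := by
  obtain ⟨M, hM⟩ := eventually_atTop.mp hcnt
  have hlin (i : ℕ) : cnt ω K b 0 (lambda β γ l ω (M + i)) =
      cnt ω K b 0 (lambda β γ l ω M) + i := by
    induction i with
    | zero => rfl
    | succ i ih => rw [← add_assoc, hM _ (Nat.le_add_right M i), ih, add_assoc]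
  have h1 : Tendsto (fun n : ℕ => (cnt ω K b 0 (lambda β γ l ω n) : ℝ) / n) atTop (𝓝 1) := by
    have h := (tendsto_const_nhds (x := (1 : ℝ))).add (tendsto_const_div_atTop_nhds_zero_nat
      ((cnt ω K b 0 (lambda β γ l ω M) : ℝ) - M))
    rw [add_zero] at h
    refine h.congr' ?_
    filter_upwards [eventually_ge_atTop M, eventually_gt_atTop 0] with n hn hn0
    obtain ⟨i, rfl⟩ := Nat.exists_eq_add_of_le hn
    have : ((M + i : ℕ) : ℝ) ≠ 0 := by positivity
    rw [hlin]
    field_simp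
    push_cast
    ring
  have hv : Tendsto (fun n => (lambda β γ l ω n).toNat + 1) atTop atTop :=
    tendsto_atTop_mono (fun n => by
      have := natCast_le_lambda β γ l ω n
      simp only [id]
      omega) tendsto_id
  have h2 := h1.div (hfreq.comp hv) hp.ne'
  have h3 := h2.sub (tendsto_one_div_atTop_nhds_zero_nat (𝕜 := ℝ))
  rw [sub_zero] at h3
  refine h3.congr' ?_
  filter_upwards [eventually_gt_atTop 0, h1.eventually_ne one_ne_zero] with n hn hne
  have hn0 : (n : ℝ) ≠ 0 := by positivity
  have hc0 : (cnt ω K b 0 (lambda β γ l ω n) : ℝ) ≠ 0 := fun h => hne (by rw [h, zero_div])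
  have hl : (((lambda β γ l ω n).toNat : ℕ) : ℤ) = lambda β γ l ω n :=
    Int.toNat_of_nonneg ((Int.natCast_nonneg n).trans (natCast_le_lambda β γ l ω n))
  have hl' : (((lambda β γ l ω n).toNat : ℕ) : ℝ) = lambda β γ l ω n := by exact_mod_cast hl
  have hl0 : (lambda β γ l ω n : ℝ) + 1 ≠ 0 := by rw [← hl']; positivity
  simp only [Pi.div_apply, Function.comp_apply, Nat.cast_add, Nat.cast_one, hl, hl',
    add_sub_cancel_right]
  field_simp
  ring

end StoppingTimes

/-- Theorem, finitarily Markovian case. If the process is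
finitarily Markovian then almost surely
`λ_n / n → 1 / p_{K(X̃⁰_{-∞})-1}(X̃_{-K(X̃⁰_{-∞})+1}^0) < ∞`; in particular the
limit of `n / λ_n` is positive. -/
theorem statement2
    {𝒳 : Type*} [Countable 𝒳] [MeasurableSpace 𝒳] [MeasurableSingletonClass 𝒳]
    (μ : Measure (Path 𝒳)) [IsProbabilityMeasure μ]
    (hErg : Ergodic (shift : Path 𝒳 → Path 𝒳) μ)
    (l : ℕ → ℕ) (hl1 : l 1 = 1) (hlmono : Monotone l)
    (hlle : ∀ k, 1 ≤ k → l k ≤ k) (hltop : Tendsto l atTop atTop)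
    (β γ : ℝ) (hγ0 : 0 < γ) (hγ1 : γ < 1) (hβ0 : 0 < β) (hβγ : 2 * β + γ < 1)
    (hFM : ∀ᵐ ω ∂μ, memLen μ (past ω) ≠ ⊤) :
    ∀ᵐ ω ∂μ,
      0 < pstr μ (memLen μ (tildePast l ω)).toNat (tildePast l ω) ∧
      Tendsto (fun n => (lambda β γ l ω n : ℝ) / (n : ℝ)) atTop
        (nhds (1 / pstr μ (memLen μ (tildePast l ω)).toNat (tildePast l ω))) := by
  have hS := hErg.toMeasurePreserving
  have hrec : ∀ᵐ ω ∂μ, ∀ (m : ℕ) (t a : ℤ), ∃ t' > a, OccursAt ω m (word ω t) t' := by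
    filter_upwards [ae_pstr_word_pos hS, ae_tendsto_cnt_div hErg] with ω hpos hfreq m t a
    exact exists_occursAt_gt (hfreq _ _) (hpos m t) a
  filter_upwards [ae_pstr_word_pos hS, ae_tendsto_cnt_div hErg, hrec,
    ae_memLen_tildePast_ne_top hS hrec hlmono hltop hFM,
    ae_eventually_abs_empCond_sub_pcond_le hS hβ0 hβγ] with ω hpos hfreq hrec hmem hconc
  have hp : 0 < pstr μ (memLen μ (tildePast l ω)).toNat (tildePast l ω) := by
    rw [← pstr_congr fun j hj => word_zeta_eq_tildePast hrec hlmono hltop le_rfl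
      (Nat.le_of_lt hj)]
    exact hpos _ _
  exact ⟨hp, tendsto_lambda_div hp (hfreq _ _) (eventually_cnt_lambda_succ hrec hlmono hltop
    (eventually_chi_eq hS hfreq hpos hβ0 hγ0 hconc hmem))⟩

end MWPrediction
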